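/- (Lemma 6.3) Let n ≥ 5 and let u be a smooth strictly convex function on a convex domain Ω ⊆ ℝⁿ satisfying equation (1.4), with u ≥ 0, u(p) = 0 at some p ∈ Ω, and let 0 < C ≤ 1 be such that S̄_u(p,C) = {ξ ∈ Ω : u(ξ) ≤ C} is a compact subset of Ω. Set α = (n+2)(n−3)/2 + (n−1)/4 and assume there are constants b₂ ≥ 0 and d > 1 such that on S̄_u(p,C): |∇u|²/(d+f)² ≤ b₂, ρ^α/(d+f)^{2nα/(n+2)} ≤ b₂, ρ^α Φ/(d+f)^{2nα/(n+2)} ≤ b₂, and |u+f| ≤ d+f. Then there is a constant d₂ > 0 depending only on n, b₂ and C such that exp(−64(n−1)C/(C−u)) · ρ^α (Σ_i ∂²u/∂ξ_i²)/(d+f)^{2nα/(n+2)+2} ≤ d₂ on S_u(p,C) = {ξ ∈ Ω : u(ξ) < C}. -/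

import Mathlib

noncomputable section

/-- The `i`-th partial derivative of a function on `ℝⁿ`. -/
def pd {n : ℕ} (i : Fin n) (f : (Fin n → ℝ) → ℝ) : (Fin n → ℝ) → ℝ :=
  fun x => fderiv ℝ f x (Pi.single i 1)

/-- The Hessian matrix `(∂²f/∂x_i∂x_j)`. -/
def hess {n : ℕ} (f : (Fin n → ℝ) → ℝ) (x : Fin n → ℝ) : Matrix (Fin n) (Fin n) ℝ :=
  Matrix.of fun i j => pd i (pd j f) x

/-- `ρ = (det D²u)^{1/(n+2)}`. -/
def rhoU {n : ℕ} (u : (Fin n → ℝ) → ℝ) (x : Fin n → ℝ) : ℝ :=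
  (hess u x).det ^ ((1 : ℝ) / (n + 2))

/-- `Φ = ‖∇ρ‖²/ρ²` with respect to the Calabi metric `G = D²u`. -/
def PhiU {n : ℕ} (u : (Fin n → ℝ) → ℝ) (x : Fin n → ℝ) : ℝ :=
  (1 / (rhoU u x) ^ 2) *
    ∑ i : Fin n, ∑ j : Fin n, (hess u x)⁻¹ i j * pd i (rhoU u) x * pd j (rhoU u) x

/-- The Legendre transform function `f(ξ) = ⟨ξ, ∇u(ξ)⟩ − u(ξ)`. -/
def legendreF {n : ℕ} (u : (Fin n → ℝ) → ℝ) (ξ : Fin n → ℝ) : ℝ :=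
  (∑ i : Fin n, ξ i * pd i u ξ) - u ξ

/-- `α = (n+2)(n−3)/2 + (n−1)/4`. -/
def alph (n : ℕ) : ℝ :=
  ((n : ℝ) + 2) * ((n : ℝ) - 3) / 2 + ((n : ℝ) - 1) / 4

open scoped ContDiff Topology
open Filter

/-- Smoothness at a point. -/
abbrev Sm {n : ℕ} (g : (Fin n → ℝ) → ℝ) (x : Fin n → ℝ) : Prop := ContDiffAt ℝ ∞ g x

open scoped MatrixOrder in
lemma psd_factor {n : ℕ} {K : Matrix (Fin n) (Fin n) ℝ} (hK : K.PosSemidef) :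
    ∃ B : Matrix (Fin n) (Fin n) ℝ, K = B.transpose * B := by
  obtain ⟨B, hB⟩ := CStarAlgebra.nonneg_iff_eq_star_mul_self.mp hK.nonneg
  exact ⟨B, by rw [hB, Matrix.star_eq_conjTranspose]; simp⟩

section calculus
variable {n : ℕ} {g h : (Fin n → ℝ) → ℝ} {x : Fin n → ℝ}

lemma Sm.diff (hg : Sm g x) : DifferentiableAt ℝ g x := hg.differentiableAt (by simp)

lemma Sm.ev_diff (hg : Sm g x) : ∀ᶠ y in 𝓝 x, DifferentiableAt ℝ g y := by
  have h1 : ContDiffAt ℝ 1 g x := hg.of_le (by exact_mod_cast le_top)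
  have h2 : ∀ᶠ y in 𝓝 x, ContDiffAt ℝ 1 g y := h1.eventually (by simp)
  filter_upwards [h2] with y hy
  exact hy.differentiableAt (by simp)

lemma Sm.pdiff (hg : Sm g x) (i : Fin n) : Sm (pd i g) x := by
  have h1 : ContDiffAt ℝ ∞ (fderiv ℝ g) x := hg.fderiv_right (by simp)
  exact ContDiffAt.clm_apply h1 (contDiffAt_const (c := (Pi.single i 1 : Fin n → ℝ)))

lemma pd_congr (h1 : g =ᶠ[𝓝 x] h) (i : Fin n) : pd i g =ᶠ[𝓝 x] pd i h := by
  filter_upwards [h1.fderiv (𝕜 := ℝ)] with y hy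
  simp [pd, hy]

lemma pd_congr_at (h1 : g =ᶠ[𝓝 x] h) (i : Fin n) : pd i g x = pd i h x :=
  (pd_congr h1 i).eq_of_nhds

lemma pd_add (hg : DifferentiableAt ℝ g x) (hh : DifferentiableAt ℝ h x) (i : Fin n) :
    pd i (fun y => g y + h y) x = pd i g x + pd i h x := by
  simp [pd, fderiv_fun_add hg hh]

lemma pd_sub (hg : DifferentiableAt ℝ g x) (hh : DifferentiableAt ℝ h x) (i : Fin n) :
    pd i (fun y => g y - h y) x = pd i g x - pd i h x := by
  simp [pd, fderiv_fun_sub hg hh]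

lemma pd_mul (hg : DifferentiableAt ℝ g x) (hh : DifferentiableAt ℝ h x) (i : Fin n) :
    pd i (fun y => g y * h y) x = pd i g x * h x + g x * pd i h x := by
  simp [pd, fderiv_fun_mul hg hh]; ring

lemma pd_const (c : ℝ) (i : Fin n) : pd i (fun _ => c) x = 0 := by
  simp [pd]

lemma pd_const_mul (hg : DifferentiableAt ℝ g x) (c : ℝ) (i : Fin n) :
    pd i (fun y => c * g y) x = c * pd i g x := by
  rw [pd_mul (by fun_prop) hg, pd_const]; ring

lemma pd_sum {ι : Type*} (s : Finset ι) {G : ι → (Fin n → ℝ) → ℝ}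
    (hG : ∀ k ∈ s, DifferentiableAt ℝ (G k) x) (i : Fin n) :
    pd i (fun y => ∑ k ∈ s, G k y) x = ∑ k ∈ s, pd i (G k) x := by
  simp [pd, fderiv_fun_sum hG]

lemma pd_coord (k i : Fin n) : pd i (fun y => y k) x = if i = k then 1 else 0 := by
  have : fderiv ℝ (fun y : Fin n → ℝ => y k) x = ContinuousLinearMap.proj k :=
    (ContinuousLinearMap.proj (R := ℝ) (φ := fun _ : Fin n => ℝ) k).hasFDerivAt.fderiv
  simp [pd, this, Pi.single_apply, eq_comm]

lemma pd_comp {F : ℝ → ℝ} {F' : ℝ} (hF : HasDerivAt F F' (g x)) (hg : DifferentiableAt ℝ g x)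
    (i : Fin n) : pd i (fun y => F (g y)) x = F' * pd i g x := by
  have := (hF.comp_hasFDerivAt x hg.hasFDerivAt).fderiv
  simp only [Function.comp_def] at this
  simp [pd, this]

lemma fderiv_eq_sum (v : Fin n → ℝ) : fderiv ℝ g x v = ∑ i, v i * pd i g x := by
  conv_lhs => rw [← Finset.univ_sum_single v]
  rw [map_sum]
  refine Finset.sum_congr rfl fun i _ => ?_
  have : (Pi.single i (v i) : Fin n → ℝ) = v i • Pi.single i 1 := by
    rw [← Pi.single_smul]; simp
  rw [this, map_smul]; simp [pd]

lemma pd_comm (hg : Sm g x) (i j : Fin n) : pd i (pd j g) x = pd j (pd i g) x := by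
  have h2 := (hg.isSymmSndFDerivAt (by simp only [minSmoothness_of_isRCLikeNormedField]; exact WithTop.coe_le_coe.2 (le_top (a := (2 : ℕ∞))))).eq
    (Pi.single i 1) (Pi.single j 1)
  have h1 : DifferentiableAt ℝ (fderiv ℝ g) x :=
    (hg.fderiv_right (m := ∞) (by simp)).differentiableAt (by simp)
  have key : ∀ i j : Fin n, pd i (pd j g) x =
      fderiv ℝ (fderiv ℝ g) x (Pi.single i 1) (Pi.single j 1) := by
    intro i j
    show fderiv ℝ (fun y => fderiv ℝ g y (Pi.single j 1)) x (Pi.single i 1) = _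
    rw [fderiv_clm_apply h1 (by fun_prop)]
    simp
  rw [key, key, h2]

/-- Second derivative along a line. -/
lemma line_deriv2 (hg : Sm g x) (v : Fin n → ℝ) :
    (∀ᶠ t in 𝓝 (0:ℝ), HasDerivAt (fun t : ℝ => g (x + t • v)) (∑ i, v i * pd i g (x + t • v)) t) ∧
    HasDerivAt (fun t : ℝ => ∑ i, v i * pd i g (x + t • v))
      (∑ i, ∑ j, v i * v j * pd i (pd j g) x) 0 := by
  have hl : ∀ t : ℝ, HasDerivAt (fun t : ℝ => x + t • v) v t := by
    intro t
    simpa using ((hasDerivAt_id t).smul_const v).const_add x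
  have hline : ∀ (k : (Fin n → ℝ) → ℝ) (t : ℝ), DifferentiableAt ℝ k (x + t • v) →
      HasDerivAt (fun t : ℝ => k (x + t • v)) (∑ i, v i * pd i k (x + t • v)) t := by
    intro k t hk
    have := hk.hasFDerivAt.comp_hasDerivAt t (hl t)
    rw [fderiv_eq_sum] at this
    exact this
  have hc : Tendsto (fun t : ℝ => x + t • v) (𝓝 0) (𝓝 x) := by
    have := (hl 0).continuousAt.tendsto
    simpa using this
  constructor
  · filter_upwards [hc.eventually hg.ev_diff] with t ht
    exact hline g t ht
  · have : ∀ j ∈ Finset.univ, HasDerivAt (fun t : ℝ => v j * pd j g (x + t • v))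
        (v j * ∑ i, v i * pd i (pd j g) x) 0 := by
      intro j _
      have := (hline (pd j g) 0 (by simpa using (hg.pdiff j).diff)).const_mul (v j)
      simpa using this
    have h3 := HasDerivAt.fun_sum this
    refine h3.congr_deriv ?_
    symm
    rw [Finset.sum_comm]
    refine Finset.sum_congr rfl fun j _ => ?_
    rw [Finset.mul_sum]
    refine Finset.sum_congr rfl fun i _ => ?_
    ring

lemma max_quad (hg : Sm g x) (hm : IsLocalMax g x) (v : Fin n → ℝ) :
    ∑ i, ∑ j, v i * v j * pd i (pd j g) x ≤ 0 := by
  obtain ⟨h1, h2⟩ := line_deriv2 hg v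
  by_contra hpos
  push Not at hpos
  set k : ℝ → ℝ := fun t => g (x + t • v) with hk
  have hder : deriv k =ᶠ[𝓝 0] fun t => ∑ i, v i * pd i g (x + t • v) := by
    filter_upwards [h1] with t ht using ht.deriv
  have hdd : deriv (deriv k) 0 = ∑ i, ∑ j, v i * v j * pd i (pd j g) x := by
    rw [hder.deriv_eq, h2.deriv]
  have hc : Tendsto (fun t : ℝ => x + t • v) (𝓝 0) (𝓝 x) := by
    have : Continuous (fun t : ℝ => x + t • v) := by fun_prop
    simpa using this.tendsto 0
  have hmax : IsLocalMax k 0 := by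
    have := hc.eventually hm
    simpa [IsLocalMax, IsMaxFilter, hk] using this
  have hd0 : deriv k 0 = 0 := hmax.deriv_eq_zero
  have hmin := isLocalMin_of_deriv_deriv_pos (hdd ▸ hpos) hd0 h1.self_of_nhds.continuousAt
  have hconst : k =ᶠ[𝓝 0] fun _ => k 0 := by
    filter_upwards [hmax, hmin] with t a b using le_antisymm a b
  have : deriv (deriv k) 0 = 0 := by
    rw [hconst.deriv.deriv_eq]; simp
  rw [hdd] at this
  linarith

lemma max_grad (hm : IsLocalMax g x) (i : Fin n) : pd i g x = 0 := by
  simp [pd, hm.fderiv_eq_zero]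

lemma max_trace (hg : Sm g x) (hm : IsLocalMax g x) {K : Matrix (Fin n) (Fin n) ℝ}
    (hK : K.PosSemidef) : ∑ i, ∑ j, K i j * pd i (pd j g) x ≤ 0 := by
  obtain ⟨B, rfl⟩ := psd_factor hK
  have : ∑ i, ∑ j, (B.transpose * B) i j * pd i (pd j g) x
      = ∑ k, ∑ i, ∑ j, B k i * B k j * pd i (pd j g) x := by
    simp only [Matrix.mul_apply, Matrix.transpose_apply, Finset.sum_mul]
    rw [Finset.sum_comm (s := Finset.univ (α := Fin n)) (t := Finset.univ (α := Fin n))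
      (f := fun k i => ∑ j, B k i * B k j * pd i (pd j g) x)]
    exact Finset.sum_congr rfl fun i _ => Finset.sum_comm
  rw [this]
  exact Finset.sum_nonpos fun k _ => max_quad hg hm _

/-- Jacobi formula. -/
lemma pd_det {M : (Fin n → ℝ) → Matrix (Fin n) (Fin n) ℝ}
    (hM : ∀ i j, DifferentiableAt ℝ (fun y => M y i j) x) (k : Fin n) :
    pd k (fun y => (M y).det) x
      = ∑ i, ∑ j, (M x).adjugate i j * pd k (fun y => M y j i) x := by
  have h1 : ∀ σ : Equiv.Perm (Fin n), HasFDerivAt (fun y => ∏ i, M y (σ i) i)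
      (∑ i, (∏ j ∈ Finset.univ.erase i, M x (σ j) j) • fderiv ℝ (fun y => M y (σ i) i) x) x := by
    intro σ
    exact HasFDerivAt.finsetProd fun i _ => (hM (σ i) i).hasFDerivAt
  have h2 : HasFDerivAt (fun y => (M y).det) (∑ σ : Equiv.Perm (Fin n), ((Equiv.Perm.sign σ : ℤ) : ℝ) •
      ∑ i, (∏ j ∈ Finset.univ.erase i, M x (σ j) j) • fderiv ℝ (fun y => M y (σ i) i) x) x := by
    have := HasFDerivAt.fun_sum (u := Finset.univ) fun σ _ =>
      (h1 σ).const_smul ((Equiv.Perm.sign σ : ℤ) : ℝ)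
    simpa [Matrix.det_apply'] using this
  have h3 : pd k (fun y => (M y).det) x = ∑ σ : Equiv.Perm (Fin n), ((Equiv.Perm.sign σ : ℤ) : ℝ) *
      ∑ i, (∏ j ∈ Finset.univ.erase i, M x (σ j) j) * pd k (fun y => M y (σ i) i) x := by
    simp [pd, h2.fderiv]
  rw [h3]
  simp only [Finset.mul_sum]
  rw [Finset.sum_comm]
  refine Finset.sum_congr rfl fun i _ => ?_
  have h4 : ∑ j, (M x).adjugate i j * pd k (fun y => M y j i) x
      = ((M x).updateCol i (fun j => pd k (fun y => M y j i) x)).det := by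
    rw [← Matrix.cramer_apply, Matrix.cramer_eq_adjugate_mulVec]
    rfl
  rw [h4, Matrix.det_apply']
  refine Finset.sum_congr rfl fun σ _ => ?_
  congr 1
  rw [← Finset.mul_prod_erase Finset.univ _ (Finset.mem_univ i), mul_comm]
  congr 1
  · simp
  · refine Finset.prod_congr rfl fun j hj => ?_
    rw [Matrix.updateCol_ne (Finset.ne_of_mem_erase hj)]

end calculus

section operator
open Matrix

/-- Gradient. -/
def gr {n : ℕ} (g : (Fin n → ℝ) → ℝ) (x : Fin n → ℝ) : Fin n → ℝ := fun i => pd i g x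

/-- Bilinear form of a matrix. -/
def ip {n : ℕ} (K : Matrix (Fin n) (Fin n) ℝ) (a b : Fin n → ℝ) : ℝ := a ⬝ᵥ (K *ᵥ b)

lemma ip_eq {n : ℕ} (K : Matrix (Fin n) (Fin n) ℝ) (a b : Fin n → ℝ) :
    ip K a b = ∑ i, ∑ j, K i j * a i * b j := by
  simp only [ip, dotProduct, mulVec, Finset.mul_sum]
  exact Finset.sum_congr rfl fun i _ => Finset.sum_congr rfl fun j _ => by ring

lemma ip_comm {n : ℕ} {K : Matrix (Fin n) (Fin n) ℝ} (hK : Kᵀ = K) (a b : Fin n → ℝ) :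
    ip K a b = ip K b a := by
  rw [ip_eq, ip_eq, Finset.sum_comm]
  refine Finset.sum_congr rfl fun i _ => Finset.sum_congr rfl fun j _ => ?_
  have : K j i = K i j := by
    conv_lhs => rw [← hK]
    rfl
  rw [this]; ring

/-- The linearized operator. -/
def Lop {n : ℕ} (K : Matrix (Fin n) (Fin n) ℝ) (dv : Fin n → ℝ)
    (g : (Fin n → ℝ) → ℝ) (x : Fin n → ℝ) : ℝ :=
  (∑ i, ∑ j, K i j * pd i (pd j g) x) + ∑ i, dv i * pd i g x

variable {n : ℕ} {K : Matrix (Fin n) (Fin n) ℝ} {dv : Fin n → ℝ}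
  {g h : (Fin n → ℝ) → ℝ} {x : Fin n → ℝ}

lemma Lop_add (hg : Sm g x) (hh : Sm h x) :
    Lop K dv (fun y => g y + h y) x = Lop K dv g x + Lop K dv h x := by
  have h1 : ∀ i j, pd i (pd j (fun y => g y + h y)) x = pd i (pd j g) x + pd i (pd j h) x := by
    intro i j
    have : pd j (fun y => g y + h y) =ᶠ[𝓝 x] fun y => pd j g y + pd j h y := by
      filter_upwards [hg.ev_diff, hh.ev_diff] with y a b using pd_add a b j
    rw [pd_congr_at this, pd_add (hg.pdiff j).diff (hh.pdiff j).diff]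
  simp only [Lop, h1, pd_add hg.diff hh.diff, mul_add, Finset.sum_add_distrib]
  ring

lemma Lop_mul (hK : Kᵀ = K) (hg : Sm g x) (hh : Sm h x) :
    Lop K dv (fun y => g y * h y) x =
      h x * Lop K dv g x + g x * Lop K dv h x + 2 * ip K (gr g x) (gr h x) := by
  have h1 : ∀ i j, pd i (pd j (fun y => g y * h y)) x =
      h x * pd i (pd j g) x + g x * pd i (pd j h) x + gr g x i * gr h x j
        + gr h x i * gr g x j := by
    intro i j
    have : pd j (fun y => g y * h y) =ᶠ[𝓝 x] fun y => pd j g y * h y + g y * pd j h y := by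
      filter_upwards [hg.ev_diff, hh.ev_diff] with y a b using pd_mul a b j
    have a1 := hg.diff
    have a2 := hh.diff
    have a3 := (hg.pdiff j).diff
    have a4 := (hh.pdiff j).diff
    rw [pd_congr_at this, pd_add (by fun_prop) (by fun_prop), pd_mul a3 a2, pd_mul a1 a4]
    simp only [gr]; ring
  have h2 : 2 * ip K (gr g x) (gr h x) = (∑ i, ∑ j, K i j * (gr g x i * gr h x j))
      + ∑ i, ∑ j, K i j * (gr h x i * gr g x j) := by
    rw [two_mul]
    nth_rewrite 2 [ip_comm hK]
    simp only [ip_eq, mul_assoc]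
  rw [h2]
  have e1 : ∀ i j, K i j * (h x * pd i (pd j g) x) = h x * (K i j * pd i (pd j g) x) := by
    intros; ring
  have e2 : ∀ i j, K i j * (g x * pd i (pd j h) x) = g x * (K i j * pd i (pd j h) x) := by
    intros; ring
  have e3 : ∀ i, dv i * (pd i g x * h x) = h x * (dv i * pd i g x) := by intros; ring
  have e4 : ∀ i, dv i * (g x * pd i h x) = g x * (dv i * pd i h x) := by intros; ring
  simp only [Lop, h1, pd_mul hg.diff hh.diff, mul_add, Finset.sum_add_distrib, e1, e2, e3, e4,
    ← Finset.mul_sum]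
  ring

lemma Lop_const (c : ℝ) : Lop K dv (fun _ => c) x = 0 := by
  have h1 : ∀ i : Fin n, pd i (fun _ : Fin n → ℝ => c) = fun _ => 0 := by
    intro i; funext y; exact pd_const c i
  simp [Lop, h1, pd_const]

lemma gr_const (c : ℝ) : gr (fun _ : Fin n → ℝ => c) x = 0 := by
  funext i; exact pd_const c i

lemma Lop_const_mul (hK : Kᵀ = K) (hg : Sm g x) (c : ℝ) :
    Lop K dv (fun y => c * g y) x = c * Lop K dv g x := by
  rw [Lop_mul hK contDiffAt_const hg, Lop_const, gr_const]
  simp [ip]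

lemma Lop_sum {ι : Type*} (s : Finset ι) {G : ι → (Fin n → ℝ) → ℝ}
    (hG : ∀ k, Sm (G k) x) :
    Lop K dv (fun y => ∑ k ∈ s, G k y) x = ∑ k ∈ s, Lop K dv (G k) x := by
  classical
  induction s using Finset.induction_on with
  | empty => simp [Lop_const]
  | insert a s ha ih =>
    simp only [Finset.sum_insert ha]
    rw [Lop_add (hG a) (ContDiffAt.sum fun k _ => hG k), ih]

lemma Lop_comp {F F1 : ℝ → ℝ} {F2 : ℝ} (hg : Sm g x)
    (h1 : ∀ᶠ t in 𝓝 (g x), HasDerivAt F (F1 t) t) (h2 : HasDerivAt F1 F2 (g x)) :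
    Lop K dv (fun y => F (g y)) x = F1 (g x) * Lop K dv g x + F2 * ip K (gr g x) (gr g x) := by
  have h3 : ∀ i j, pd i (pd j (fun y => F (g y))) x =
      F1 (g x) * pd i (pd j g) x + F2 * (gr g x i * gr g x j) := by
    intro i j
    have : pd j (fun y => F (g y)) =ᶠ[𝓝 x] fun y => F1 (g y) * pd j g y := by
      filter_upwards [hg.ev_diff, hg.continuousAt.eventually h1] with y a b using pd_comp b a j
    rw [pd_congr_at this, pd_mul (g := fun y => F1 (g y)) (h2.differentiableAt.comp x hg.diff)
      (hg.pdiff j).diff, pd_comp h2 hg.diff]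
    simp only [gr]; ring
  have e1 : ∀ i j, K i j * (F1 (g x) * pd i (pd j g) x) = F1 (g x) * (K i j * pd i (pd j g) x) := by
    intros; ring
  have e2 : ∀ i j, K i j * (F2 * (gr g x i * gr g x j)) = F2 * (K i j * gr g x i * gr g x j) := by
    intros; ring
  have e3 : ∀ i, dv i * (F1 (g x) * pd i g x) = F1 (g x) * (dv i * pd i g x) := by intros; ring
  simp only [Lop, h3, pd_comp h1.self_of_nhds hg.diff, mul_add, Finset.sum_add_distrib, e1, e2, e3,
    ← Finset.mul_sum, ip_eq]
  ring

lemma Lop_log (hg : Sm g x) (h0 : 0 < g x) :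
    Lop K dv (fun y => Real.log (g y)) x
      = Lop K dv g x / g x - ip K (gr g x) (gr g x) / (g x) ^ 2 := by
  rw [Lop_comp (F := Real.log) (F1 := fun t => t⁻¹) (F2 := -((g x) ^ 2)⁻¹) hg]
  · ring
  · filter_upwards [lt_mem_nhds h0] with t ht using Real.hasDerivAt_log ht.ne'
  · exact hasDerivAt_inv h0.ne'

lemma pd_log (hg : Sm g x) (h0 : 0 < g x) (i : Fin n) :
    pd i (fun y => Real.log (g y)) x = pd i g x / g x := by
  rw [pd_comp (Real.hasDerivAt_log h0.ne') hg.diff]; ring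

lemma hasDerivAt_invsq {t : ℝ} (ht : 0 < t) :
    HasDerivAt (fun t : ℝ => (t ^ 2)⁻¹) (-2 * (t ^ 3)⁻¹) t := by
  have := (hasDerivAt_pow 2 t).fun_inv (by positivity)
  refine this.congr_deriv ?_
  simp; field_simp

lemma Lop_invsq (hg : Sm g x) (h0 : 0 < g x) :
    Lop K dv (fun y => ((g y) ^ 2)⁻¹) x
      = -2 / (g x) ^ 3 * Lop K dv g x + 6 / (g x) ^ 4 * ip K (gr g x) (gr g x) := by
  rw [Lop_comp (F := fun t => (t ^ 2)⁻¹) (F1 := fun t => -2 * (t ^ 3)⁻¹) (F2 := 6 / (g x) ^ 4) hg]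
  · ring
  · filter_upwards [lt_mem_nhds h0] with t ht using hasDerivAt_invsq ht
  · have := ((hasDerivAt_pow 3 (g x)).fun_inv (by positivity)).const_mul (-2)
    refine this.congr_deriv ?_
    simp; field_simp; ring

lemma pd_invsq (hg : Sm g x) (h0 : 0 < g x) (i : Fin n) :
    pd i (fun y => ((g y) ^ 2)⁻¹) x = -2 / (g x) ^ 3 * pd i g x := by
  rw [pd_comp (F := fun t => (t ^ 2)⁻¹) (hasDerivAt_invsq h0) hg.diff]; ring

lemma gr_invsq (hg : Sm g x) (h0 : 0 < g x) :
    gr (fun y => ((g y) ^ 2)⁻¹) x = (-2 / (g x) ^ 3) • gr g x := by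
  funext i; exact pd_invsq hg h0 i

lemma ip_smul_right (a b : Fin n → ℝ) (c : ℝ) : ip K a (c • b) = c * ip K a b := by
  simp [ip, mulVec_smul]

/-- The test function. -/
def phiT {n : ℕ} (N α q ε : ℝ) (s l w E P : (Fin n → ℝ) → ℝ) : (Fin n → ℝ) → ℝ := fun y =>
  (N * Real.log (s y) + α * l y) + (Real.log (w y) + (-q) * Real.log (E y))
    + ε * (P y * ((E y) ^ 2)⁻¹)

variable {s l w E P : (Fin n → ℝ) → ℝ} {N α q ε : ℝ}

lemma phiT_calc (hK : Kᵀ = K) (hs : Sm s x) (hl : Sm l x) (hw : Sm w x) (hE : Sm E x) (hP : Sm P x)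
    (s0 : 0 < s x) (w0 : 0 < w x) (E0 : 0 < E x) :
    Sm (phiT N α q ε s l w E P) x ∧
    (∀ i, pd i (phiT N α q ε s l w E P) x =
      N * (pd i s x / s x) + α * pd i l x + pd i w x / w x - q * (pd i E x / E x)
        + ε * (pd i P x / (E x) ^ 2 - 2 * P x / (E x) ^ 3 * pd i E x)) ∧
    Lop K dv (phiT N α q ε s l w E P) x =
      N * (Lop K dv s x / s x - ip K (gr s x) (gr s x) / (s x) ^ 2) + α * Lop K dv l x
      + (Lop K dv w x / w x - ip K (gr w x) (gr w x) / (w x) ^ 2)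
      - q * (Lop K dv E x / E x - ip K (gr E x) (gr E x) / (E x) ^ 2)
      + ε * (Lop K dv P x / (E x) ^ 2 - 4 / (E x) ^ 3 * ip K (gr P x) (gr E x)
        + P x * (-2 / (E x) ^ 3 * Lop K dv E x + 6 / (E x) ^ 4 * ip K (gr E x) (gr E x))) := by
  have m1 : Sm (fun y => Real.log (s y)) x := hs.log s0.ne'
  have m2 : Sm (fun y => Real.log (w y)) x := hw.log w0.ne'
  have m3 : Sm (fun y => Real.log (E y)) x := hE.log E0.ne'
  have m4 : Sm (fun y => ((E y) ^ 2)⁻¹) x := (hE.pow 2).inv (by positivity)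
  have k1 : Sm (fun y => N * Real.log (s y)) x := contDiffAt_const.mul m1
  have k2 : Sm (fun y => α * l y) x := contDiffAt_const.mul hl
  have k3 : Sm (fun y => (-q) * Real.log (E y)) x := contDiffAt_const.mul m3
  have k4 : Sm (fun y => P y * ((E y) ^ 2)⁻¹) x := hP.mul m4
  have k5 : Sm (fun y => ε * (P y * ((E y) ^ 2)⁻¹)) x := contDiffAt_const.mul k4
  have j1 : Sm (fun y => N * Real.log (s y) + α * l y) x := k1.add k2
  have j2 : Sm (fun y => Real.log (w y) + (-q) * Real.log (E y)) x := m2.add k3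
  have j3 : Sm (fun y => (N * Real.log (s y) + α * l y) + (Real.log (w y) + (-q) * Real.log (E y))) x :=
    j1.add j2
  refine ⟨j3.add k5, fun i => ?_, ?_⟩
  · unfold phiT
    rw [pd_add j3.diff k5.diff, pd_add j1.diff j2.diff, pd_add k1.diff k2.diff,
      pd_add m2.diff k3.diff, pd_const_mul m1.diff, pd_const_mul hl.diff, pd_const_mul m3.diff,
      pd_const_mul k4.diff, pd_mul hP.diff m4.diff, pd_log hs s0, pd_log hw w0, pd_log hE E0,
      pd_invsq hE E0]
    field_simp; ring
  · unfold phiT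
    rw [Lop_add j3 k5, Lop_add j1 j2, Lop_add k1 k2,
      Lop_add m2 k3, Lop_const_mul hK m1, Lop_const_mul hK hl, Lop_const_mul hK m3,
      Lop_const_mul hK k4, Lop_mul hK hP m4, Lop_log hs s0, Lop_log hw w0, Lop_log hE E0,
      Lop_invsq hE E0, gr_invsq hE E0, ip_smul_right]
    field_simp; ring

end operator

section pde
open Matrix

variable {n : ℕ} {Ω : Set (Fin n → ℝ)} {u : (Fin n → ℝ) → ℝ} {dv : Fin n → ℝ} {d0 : ℝ}
  {x : Fin n → ℝ}

lemma Sm_det {M : (Fin n → ℝ) → Matrix (Fin n) (Fin n) ℝ}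
    (hM : ∀ i j, Sm (fun y => M y i j) x) : Sm (fun y => (M y).det) x := by
  simp only [Matrix.det_apply']
  exact ContDiffAt.sum fun σ _ => contDiffAt_const.mul (contDiffAt_prod fun i _ => hM _ _)

lemma Sm_adj {M : (Fin n → ℝ) → Matrix (Fin n) (Fin n) ℝ}
    (hM : ∀ i j, Sm (fun y => M y i j) x) (i j : Fin n) :
    Sm (fun y => (M y).adjugate i j) x := by
  simp only [Matrix.adjugate_apply]
  refine Sm_det fun a b => ?_
  by_cases h : a = j
  · subst h; simpa using contDiffAt_const
  · simpa [Matrix.updateRow_ne h] using hM a b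

lemma inv_entry (M : Matrix (Fin n) (Fin n) ℝ) (i j : Fin n) :
    M⁻¹ i j = (M.det)⁻¹ * M.adjugate i j := by
  simp [Matrix.inv_def]

lemma Sm_inv {M : (Fin n → ℝ) → Matrix (Fin n) (Fin n) ℝ}
    (hM : ∀ i j, Sm (fun y => M y i j) x) (h0 : (M x).det ≠ 0) (i j : Fin n) :
    Sm (fun y => (M y)⁻¹ i j) x := by
  simp only [inv_entry]
  exact ((Sm_det hM).inv h0).mul (Sm_adj hM i j)

/-- derivative of a matrix -/
def pdM (k : Fin n) (M : (Fin n → ℝ) → Matrix (Fin n) (Fin n) ℝ) (x : Fin n → ℝ) :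
    Matrix (Fin n) (Fin n) ℝ := Matrix.of fun i j => pd k (fun y => M y i j) x

lemma pdM_inv {M : (Fin n → ℝ) → Matrix (Fin n) (Fin n) ℝ}
    (hM : ∀ i j, Sm (fun y => M y i j) x) (h0 : (M x).det ≠ 0) (k : Fin n) :
    pdM k (fun y => (M y)⁻¹) x = -((M x)⁻¹ * pdM k M x * (M x)⁻¹) := by
  have hI := Sm_inv hM h0
  have hev : ∀ᶠ y in 𝓝 x, (M y).det ≠ 0 :=
    (Sm_det hM).continuousAt.eventually_ne h0
  have key : pdM k M x * (M x)⁻¹ + M x * pdM k (fun y => (M y)⁻¹) x = 0 := by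
    ext i j
    have h1 : (fun y => ∑ l, M y i l * (M y)⁻¹ l j) =ᶠ[𝓝 x]
        fun _ => (1 : Matrix (Fin n) (Fin n) ℝ) i j := by
      filter_upwards [hev] with y hy
      rw [← Matrix.mul_apply, Matrix.mul_nonsing_inv _ (isUnit_iff_ne_zero.2 hy)]
    have h2 := pd_congr_at h1 k
    rw [pd_const, pd_sum (G := fun l y => M y i l * (M y)⁻¹ l j) _
      fun l _ => (hM i l).diff.fun_mul (hI l j).diff] at h2
    simp only [pd_mul (hM i _).diff (hI _ j).diff, Finset.sum_add_distrib] at h2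
    simpa [Matrix.add_apply, Matrix.mul_apply, pdM] using h2
  have hu : IsUnit (M x).det := isUnit_iff_ne_zero.2 h0
  have h3 : M x * pdM k (fun y => (M y)⁻¹) x = -(pdM k M x * (M x)⁻¹) :=
    eq_neg_of_add_eq_zero_right key
  calc pdM k (fun y => (M y)⁻¹) x = (M x)⁻¹ * (M x * pdM k (fun y => (M y)⁻¹) x) := by
        rw [← Matrix.mul_assoc, Matrix.nonsing_inv_mul _ hu, Matrix.one_mul]
    _ = _ := by rw [h3, Matrix.mul_neg, Matrix.mul_assoc]

lemma Sm_hess (hu : Sm u x) (i j : Fin n) : Sm (fun y => hess u y i j) x :=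
  (hu.pdiff j).pdiff i

lemma hess_symm (hu : Sm u x) : (hess u x)ᵀ = hess u x := by
  ext i j
  exact pd_comm hu j i

lemma hess_inv_symm (hu : Sm u x) : ((hess u x)⁻¹)ᵀ = (hess u x)⁻¹ := by
  rw [Matrix.transpose_nonsing_inv, hess_symm hu]

lemma Sm_ev (hΩ : IsOpen Ω) (hu : ∀ y ∈ Ω, Sm u y) (hx : x ∈ Ω) : ∀ᶠ y in 𝓝 x, Sm u y := by
  filter_upwards [hΩ.mem_nhds hx] with y hy using hu y hy

lemma pd_comm3 (hΩ : IsOpen Ω) (hu : ∀ y ∈ Ω, Sm u y) (hx : x ∈ Ω) (i j k : Fin n) :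
    pd i (pd j (pd k u)) x = pd k (pd i (pd j u)) x := by
  have h1 : pd j (pd k u) =ᶠ[𝓝 x] pd k (pd j u) := by
    filter_upwards [Sm_ev hΩ hu hx] with y hy using pd_comm hy j k
  rw [pd_congr_at h1, pd_comm ((hu x hx).pdiff j)]

lemma first_id (hΩ : IsOpen Ω) (hu : ∀ y ∈ Ω, Sm u y)
    (hpd : ∀ y ∈ Ω, (hess u y).PosDef)
    (heq : ∀ ξ ∈ Ω, (hess u ξ).det = Real.exp (-(∑ i : Fin n, dv i * pd i u ξ) - d0))
    (hx : x ∈ Ω) (k : Fin n) :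
    (∑ i, ∑ j, (hess u x)⁻¹ i j * pd k (fun y => hess u y j i) x)
      + ∑ i, dv i * pd k (pd i u) x = 0 := by
  have hux := hu x hx
  have h1 := pd_det (M := hess u) (fun i j => (Sm_hess hux i j).diff) k
  have h2 : (fun y => (hess u y).det) =ᶠ[𝓝 x]
      fun y => Real.exp (-(∑ i : Fin n, dv i * pd i u y) - d0) := by
    filter_upwards [hΩ.mem_nhds hx] with y hy using heq y hy
  have hd : ∀ i ∈ Finset.univ, DifferentiableAt ℝ (fun y => dv i * pd i u y) x := fun i _ =>
    (hux.pdiff i).diff.const_mul _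
  have hd1 : DifferentiableAt ℝ (fun y => ∑ i, dv i * pd i u y) x := DifferentiableAt.fun_sum hd
  have h3 : pd k (fun y => Real.exp (-(∑ i : Fin n, dv i * pd i u y) - d0)) x =
      (hess u x).det * -(∑ i, dv i * pd k (pd i u) x) := by
    rw [pd_comp (g := fun y => -(∑ i : Fin n, dv i * pd i u y) - d0) (Real.hasDerivAt_exp _)
      (by fun_prop), ← heq x hx]
    congr 1
    rw [pd_sub (by fun_prop) (by fun_prop), pd_const]
    have : (fun y => -(∑ i : Fin n, dv i * pd i u y)) = fun y => (-1) * ∑ i, dv i * pd i u y := by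
      funext y; ring
    rw [this, pd_const_mul hd1, pd_sum _ hd]
    simp only [pd_const_mul (hux.pdiff _).diff]
    ring
  have hdet : 0 < (hess u x).det := (hpd x hx).det_pos
  rw [pd_congr_at h2, h3] at h1
  simp only [inv_entry, mul_assoc, ← Finset.mul_sum]
  rw [← h1]
  field_simp; ring

lemma Lop_pd (hΩ : IsOpen Ω) (hu : ∀ y ∈ Ω, Sm u y)
    (hpd : ∀ y ∈ Ω, (hess u y).PosDef)
    (heq : ∀ ξ ∈ Ω, (hess u ξ).det = Real.exp (-(∑ i : Fin n, dv i * pd i u ξ) - d0))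
    (hx : x ∈ Ω) (k : Fin n) : Lop (hess u x)⁻¹ dv (pd k u) x = 0 := by
  rw [← first_id hΩ hu hpd heq hx k, Lop]
  congr 1
  · refine Finset.sum_congr rfl fun i _ => Finset.sum_congr rfl fun j _ => ?_
    congr 1
    rw [pd_comm ((hu x hx).pdiff k), pd_comm3 hΩ hu hx]
    rfl
  · refine Finset.sum_congr rfl fun i _ => ?_
    rw [pd_comm (hu x hx)]

lemma Lop_pd2 (hΩ : IsOpen Ω) (hu : ∀ y ∈ Ω, Sm u y)
    (hpd : ∀ y ∈ Ω, (hess u y).PosDef)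
    (heq : ∀ ξ ∈ Ω, (hess u ξ).det = Real.exp (-(∑ i : Fin n, dv i * pd i u ξ) - d0))
    (hx : x ∈ Ω) (l k : Fin n) : Lop (hess u x)⁻¹ dv (pd l (pd k u)) x =
      ((hess u x)⁻¹ * pdM l (hess u) x * (hess u x)⁻¹ * pdM k (hess u) x).trace := by
  have hux := hu x hx
  have hdet : (hess u x).det ≠ 0 := (hpd x hx).det_pos.ne'
  have hKs := Sm_inv (fun i j => Sm_hess hux i j) hdet
  have hH : ∀ j i, Sm (pd k (fun y => hess u y j i)) x := fun j i => (Sm_hess hux j i).pdiff k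
  have hev : (fun y => (∑ i, ∑ j, (hess u y)⁻¹ i j * pd k (fun y => hess u y j i) y)
      + ∑ i, dv i * pd k (pd i u) y) =ᶠ[𝓝 x] fun _ => 0 := by
    filter_upwards [hΩ.mem_nhds hx] with y hy using first_id hΩ hu hpd heq hy k
  have h1 := pd_congr_at hev l
  have hd1 : ∀ i ∈ Finset.univ, ∀ j ∈ Finset.univ, DifferentiableAt ℝ
      (fun y => (hess u y)⁻¹ i j * pd k (fun y => hess u y j i) y) x := fun i _ j _ =>
    (hKs i j).diff.mul (hH j i).diff
  have hd2 : ∀ i ∈ Finset.univ, DifferentiableAt ℝ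
      (fun y => ∑ j, (hess u y)⁻¹ i j * pd k (fun y => hess u y j i) y) x := fun i hi =>
    DifferentiableAt.fun_sum (hd1 i hi)
  have hd3 : ∀ i ∈ Finset.univ, DifferentiableAt ℝ (fun y => dv i * pd k (pd i u) y) x :=
    fun i _ => ((hux.pdiff i).pdiff k).diff.const_mul _
  rw [pd_const, pd_add (DifferentiableAt.fun_sum hd2) (DifferentiableAt.fun_sum hd3), pd_sum _ hd2,
    pd_sum _ hd3, Finset.sum_congr rfl fun i hi => pd_sum _ (hd1 i hi) l] at h1
  simp only [pd_mul (hKs _ _).diff (hH _ _).diff, pd_const_mul ((hux.pdiff _).pdiff k).diff,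
    Finset.sum_add_distrib] at h1
  have hinv : ∀ i j, pd l (fun y => (hess u y)⁻¹ i j) x
      = -((hess u x)⁻¹ * pdM l (hess u) x * (hess u x)⁻¹) i j := fun i j => by
    have := congrFun (congrFun (pdM_inv (fun i j => Sm_hess hux i j) hdet l) i) j
    simpa [pdM] using this
  have ht : ((hess u x)⁻¹ * pdM l (hess u) x * (hess u x)⁻¹ * pdM k (hess u) x).trace
      = - ∑ i, ∑ j, pd l (fun y => (hess u y)⁻¹ i j) x * pd k (fun y => hess u y j i) x := by
    simp only [hinv, Matrix.trace, Matrix.diag_apply]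
    rw [← Finset.sum_neg_distrib]
    refine Finset.sum_congr rfl fun i _ => ?_
    rw [Matrix.mul_apply, ← Finset.sum_neg_distrib]
    refine Finset.sum_congr rfl fun j _ => ?_
    simp [pdM]
  have e1 : ∀ i j, pd i (pd j (pd l (pd k u))) x = pd l (pd k (fun y => hess u y j i)) x := by
    intro i j
    have hk := hux.pdiff k
    have hΩk : ∀ y ∈ Ω, Sm (pd k u) y := fun y hy => (hu y hy).pdiff k
    rw [pd_comm3 hΩ hΩk hx]
    refine pd_congr_at ?_ l
    filter_upwards [hΩ.mem_nhds hx] with y hy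
    rw [pd_comm (hΩk y hy), pd_comm3 hΩ hu hy]
    rfl
  have e2 : ∀ i, pd i (pd l (pd k u)) x = pd l (pd k (pd i u)) x := by
    intro i
    rw [pd_comm (hux.pdiff k)]
    refine pd_congr_at ?_ l
    filter_upwards [hΩ.mem_nhds hx] with y hy using pd_comm (hu y hy) i k
  rw [ht, Lop]
  simp only [e1, e2]
  linarith

end pde

section pde2
open Matrix

variable {n : ℕ} {Ω : Set (Fin n → ℝ)} {u : (Fin n → ℝ) → ℝ} {dv : Fin n → ℝ} {d0 : ℝ}
  {x : Fin n → ℝ}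

lemma gr_pd (k : Fin n) : gr (pd k u) x = hess u x *ᵥ Pi.single k 1 := by
  funext i
  simp [gr, hess]

lemma ip_gr_pd (hu : Sm u x) (hpd : (hess u x).PosDef) (k : Fin n) (b : Fin n → ℝ) :
    ip (hess u x)⁻¹ (gr (pd k u) x) b = b k := by
  have hdet : IsUnit (hess u x).det := isUnit_iff_ne_zero.2 hpd.det_pos.ne'
  rw [ip_comm (hess_inv_symm hu), ip, gr_pd, mulVec_mulVec, nonsing_inv_mul _ hdet, one_mulVec, dotProduct_single_one]

lemma Lop_u (hpd : (hess u x).PosDef) :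
    Lop (hess u x)⁻¹ dv u x = n + dv ⬝ᵥ gr u x := by
  have hdet : IsUnit (hess u x).det := isUnit_iff_ne_zero.2 hpd.det_pos.ne'
  have hs : (hess u x)ᵀ = hess u x := by simpa using hpd.1.eq
  have h1 : ∑ i, ∑ j, (hess u x)⁻¹ i j * pd i (pd j u) x
      = ((hess u x)⁻¹ * (hess u x)ᵀ).trace := by
    simp only [Matrix.trace, Matrix.diag_apply, Matrix.mul_apply, Matrix.transpose_apply]
    rfl
  rw [Lop, h1, hs, nonsing_inv_mul _ hdet]
  simp [dotProduct, gr]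

lemma Lop_coord (K : Matrix (Fin n) (Fin n) ℝ) (k : Fin n) :
    Lop K dv (fun y => y k) x = dv k := by
  have h : ∀ i : Fin n, pd i (fun y : Fin n → ℝ => y k) = fun _ => if i = k then 1 else 0 := by
    intro i; funext y; exact pd_coord k i
  simp [Lop, h, pd_const]

lemma Sm_coord (k : Fin n) : Sm (fun y : Fin n → ℝ => y k) x := (contDiff_apply ℝ ℝ k).contDiffAt

lemma Sm_leg (hu : Sm u x) : Sm (legendreF u) x := by
  unfold legendreF
  exact (ContDiffAt.sum fun i _ => (Sm_coord i).mul (hu.pdiff i)).sub hu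

lemma leg_id (hΩ : IsOpen Ω) (hu : ∀ y ∈ Ω, Sm u y)
    (hpd : ∀ y ∈ Ω, (hess u y).PosDef)
    (heq : ∀ ξ ∈ Ω, (hess u ξ).det = Real.exp (-(∑ i : Fin n, dv i * pd i u ξ) - d0))
    (hx : x ∈ Ω) (d : ℝ) :
    Lop (hess u x)⁻¹ dv (fun y => d + legendreF u y) x = n := by
  have hux := hu x hx
  have h1 : ∀ k, Sm (fun y => y k * pd k u y) x := fun k => (Sm_coord k).mul (hux.pdiff k)
  have h2 : Sm (fun y => ∑ k, y k * pd k u y) x := ContDiffAt.sum fun k _ => h1 k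
  have hK := hess_inv_symm hux
  have h3 : Sm (fun y => (-1) * u y) x := contDiffAt_const.mul hux
  have hE : (fun y => d + legendreF u y) = fun y => d + ((∑ k, y k * pd k u y) + (-1) * u y) := by
    funext y; simp only [legendreF]; ring
  rw [hE, Lop_add contDiffAt_const (h2.add h3), Lop_add h2 h3, Lop_const, Lop_sum _ h1,
    Lop_const_mul hK hux, Lop_u (hpd x hx)]
  have h4 : ∀ k, Lop (hess u x)⁻¹ dv (fun y => y k * pd k u y) x = pd k u x * dv k + 2 := by
    intro k
    rw [Lop_mul hK (Sm_coord k) (hux.pdiff k), Lop_coord, Lop_pd hΩ hu hpd heq hx,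
      ip_comm hK, ip_gr_pd hux (hpd x hx)]
    simp [gr, pd_coord]
  simp only [h4, Finset.sum_add_distrib, dotProduct, gr]
  have : ∑ k, pd k u x * dv k = ∑ k, dv k * pd k u x := Finset.sum_congr rfl fun k _ => mul_comm _ _
  rw [this]
  simp; ring

lemma P_id (hΩ : IsOpen Ω) (hu : ∀ y ∈ Ω, Sm u y)
    (hpd : ∀ y ∈ Ω, (hess u y).PosDef)
    (heq : ∀ ξ ∈ Ω, (hess u ξ).det = Real.exp (-(∑ i : Fin n, dv i * pd i u ξ) - d0))
    (hx : x ∈ Ω) :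
    Sm (fun y => ∑ k, (pd k u y) ^ 2) x ∧
    gr (fun y => ∑ k, (pd k u y) ^ 2) x = (2 : ℝ) • (hess u x *ᵥ gr u x) ∧
    Lop (hess u x)⁻¹ dv (fun y => ∑ k, (pd k u y) ^ 2) x = 2 * (hess u x).trace := by
  have hux := hu x hx
  have hK := hess_inv_symm hux
  have h1 : ∀ k, Sm (fun y => pd k u y * pd k u y) x := fun k => (hux.pdiff k).mul (hux.pdiff k)
  simp only [pow_two]
  refine ⟨ContDiffAt.sum fun k _ => h1 k, ?_, ?_⟩
  · funext i
    simp only [gr]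
    rw [pd_sum _ fun k _ => (h1 k).diff]
    simp only [pd_mul (hux.pdiff _).diff (hux.pdiff _).diff, Pi.smul_apply, smul_eq_mul, mulVec,
      dotProduct, hess, of_apply, Finset.mul_sum]
    exact Finset.sum_congr rfl fun k _ => by simp only [gr]; ring
  · rw [Lop_sum _ h1]
    simp only [Lop_mul hK (hux.pdiff _) (hux.pdiff _), Lop_pd hΩ hu hpd heq hx,
      ip_gr_pd hux (hpd x hx), trace, diag_apply, Finset.mul_sum]
    exact Finset.sum_congr rfl fun k _ => by simp [gr, hess]

/-- `log ρ` -/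
def lrho (n : ℕ) (u : (Fin n → ℝ) → ℝ) (dv : Fin n → ℝ) (d0 : ℝ) : (Fin n → ℝ) → ℝ := fun y =>
  (∑ i, (-(dv i) / ((n : ℝ) + 2)) * pd i u y) + (-d0 / ((n : ℝ) + 2))

lemma l_id (hΩ : IsOpen Ω) (hu : ∀ y ∈ Ω, Sm u y)
    (hpd : ∀ y ∈ Ω, (hess u y).PosDef)
    (heq : ∀ ξ ∈ Ω, (hess u ξ).det = Real.exp (-(∑ i : Fin n, dv i * pd i u ξ) - d0))
    (hx : x ∈ Ω) :
    Sm (lrho n u dv d0) x ∧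
    gr (lrho n u dv d0) x = hess u x *ᵥ ((-(1 / ((n : ℝ) + 2))) • dv) ∧
    Lop (hess u x)⁻¹ dv (lrho n u dv d0) x = 0 ∧
    rhoU u =ᶠ[𝓝 x] (fun y => Real.exp (lrho n u dv d0 y)) := by
  have hux := hu x hx
  have hK := hess_inv_symm hux
  have h1 : ∀ k, Sm (fun y => (-(dv k) / ((n : ℝ) + 2)) * pd k u y) x := fun k =>
    contDiffAt_const.mul (hux.pdiff k)
  have h2 : Sm (fun y => ∑ k, (-(dv k) / ((n : ℝ) + 2)) * pd k u y) x :=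
    ContDiffAt.sum fun k _ => h1 k
  refine ⟨h2.add contDiffAt_const, ?_, ?_, ?_⟩
  · funext i
    simp only [gr]
    unfold lrho
    rw [pd_add h2.diff (by fun_prop), pd_const, pd_sum _ fun k _ => (h1 k).diff]
    simp only [pd_const_mul (hux.pdiff _).diff, Pi.smul_apply, smul_eq_mul, mulVec,
      dotProduct, hess, of_apply, add_zero]
    exact Finset.sum_congr rfl fun k _ => by ring
  · unfold lrho
    rw [Lop_add h2 contDiffAt_const, Lop_const, Lop_sum _ h1]
    simp only [Lop_const_mul hK (hux.pdiff _), Lop_pd hΩ hu hpd heq hx]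
    simp
  · filter_upwards [hΩ.mem_nhds hx] with y hy
    rw [rhoU, heq y hy, ← Real.exp_mul]
    congr 1
    have hn : (n : ℝ) + 2 ≠ 0 := by positivity
    simp only [lrho]
    have : ∑ i, (-(dv i) / ((n : ℝ) + 2)) * pd i u y
        = -(1 / ((n : ℝ) + 2)) * ∑ i, dv i * pd i u y := by
      rw [Finset.mul_sum]
      exact Finset.sum_congr rfl fun k _ => by ring
    rw [this]; field_simp; ring

lemma Phi_id (hΩ : IsOpen Ω) (hu : ∀ y ∈ Ω, Sm u y)
    (hpd : ∀ y ∈ Ω, (hess u y).PosDef)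
    (heq : ∀ ξ ∈ Ω, (hess u ξ).det = Real.exp (-(∑ i : Fin n, dv i * pd i u ξ) - d0))
    (hx : x ∈ Ω) :
    PhiU u x = ip (hess u x)⁻¹ (gr (lrho n u dv d0) x) (gr (lrho n u dv d0) x) := by
  obtain ⟨hl, -, -, hev⟩ := l_id hΩ hu hpd heq hx
  have h1 : ∀ i, pd i (rhoU u) x = rhoU u x * gr (lrho n u dv d0) x i := by
    intro i
    rw [pd_congr_at hev, pd_comp (Real.hasDerivAt_exp _) hl.diff, hev.eq_of_nhds]
    rfl
  have h0 : 0 < rhoU u x := by rw [hev.eq_of_nhds]; exact Real.exp_pos _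
  rw [PhiU, ip_eq, Finset.mul_sum]
  refine Finset.sum_congr rfl fun i _ => ?_
  rw [Finset.mul_sum]
  refine Finset.sum_congr rfl fun j _ => ?_
  rw [h1, h1]
  field_simp

lemma Lop_u' (hΩ : IsOpen Ω) (hu : ∀ y ∈ Ω, Sm u y)
    (hpd : ∀ y ∈ Ω, (hess u y).PosDef)
    (heq : ∀ ξ ∈ Ω, (hess u ξ).det = Real.exp (-(∑ i : Fin n, dv i * pd i u ξ) - d0))
    (hx : x ∈ Ω) :
    Lop (hess u x)⁻¹ dv u x
      = n - ((n : ℝ) + 2) * ip (hess u x)⁻¹ (gr (lrho n u dv d0) x) (gr u x) := by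
  obtain ⟨-, hg, -, -⟩ := l_id hΩ hu hpd heq hx
  have hdet : IsUnit (hess u x).det := isUnit_iff_ne_zero.2 (hpd x hx).det_pos.ne'
  rw [Lop_u (hpd x hx), hg, ip_comm (hess_inv_symm (hu x hx)), ip, mulVec_mulVec,
    nonsing_inv_mul _ hdet, one_mulVec, dotProduct_smul, dotProduct_comm]
  have hn : (n : ℝ) + 2 ≠ 0 := by positivity
  simp only [smul_eq_mul]
  field_simp
  ring

/-- second directional derivative -/
def wdir {n : ℕ} (u : (Fin n → ℝ) → ℝ) (e : Fin n → ℝ) : (Fin n → ℝ) → ℝ := fun y =>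
  ∑ k, ∑ l, (e k * e l) * pd k (pd l u) y

/-- third derivative contracted with a direction -/
def AM {n : ℕ} (u : (Fin n → ℝ) → ℝ) (e : Fin n → ℝ) (x : Fin n → ℝ) : Matrix (Fin n) (Fin n) ℝ :=
  ∑ k, e k • pdM k (hess u) x

lemma w_id (hΩ : IsOpen Ω) (hu : ∀ y ∈ Ω, Sm u y)
    (hpd : ∀ y ∈ Ω, (hess u y).PosDef)
    (heq : ∀ ξ ∈ Ω, (hess u ξ).det = Real.exp (-(∑ i : Fin n, dv i * pd i u ξ) - d0))
    (hx : x ∈ Ω) (e : Fin n → ℝ) :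
    Sm (wdir u e) x ∧ wdir u e x = ip (hess u x) e e ∧
    gr (wdir u e) x = AM u e x *ᵥ e ∧ (AM u e x)ᵀ = AM u e x ∧
    Lop (hess u x)⁻¹ dv (wdir u e) x
      = ((hess u x)⁻¹ * AM u e x * (hess u x)⁻¹ * AM u e x).trace := by
  have hux := hu x hx
  have hK := hess_inv_symm hux
  have h1 : ∀ k l, Sm (fun y => (e k * e l) * pd k (pd l u) y) x := fun k l =>
    contDiffAt_const.mul ((hux.pdiff l).pdiff k)
  have h2 : ∀ k, Sm (fun y => ∑ l, (e k * e l) * pd k (pd l u) y) x := fun k =>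
    ContDiffAt.sum fun l _ => h1 k l
  refine ⟨ContDiffAt.sum fun k _ => h2 k, ?_, ?_, ?_, ?_⟩
  · rw [ip_eq]
    exact Finset.sum_congr rfl fun k _ => Finset.sum_congr rfl fun l _ => by
      simp [hess]; ring
  · funext i
    simp only [gr]
    unfold wdir
    rw [pd_sum _ fun k _ => (h2 k).diff, Finset.sum_congr rfl fun k _ =>
      pd_sum _ (fun l _ => (h1 k l).diff) i]
    simp only [pd_const_mul ((hux.pdiff _).pdiff _).diff, mulVec, dotProduct, AM, Matrix.sum_apply,
      Matrix.smul_apply, smul_eq_mul, Finset.sum_mul, pdM, hess, of_apply]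
    rw [Finset.sum_comm]
    refine Finset.sum_congr rfl fun l _ => Finset.sum_congr rfl fun k _ => ?_
    rw [pd_comm (hux.pdiff l)]
    ring
  · ext i j
    simp only [AM, transpose_apply, Matrix.sum_apply, Matrix.smul_apply, pdM, of_apply]
    refine Finset.sum_congr rfl fun k _ => ?_
    congr 1
    refine pd_congr_at ?_ k
    filter_upwards [hΩ.mem_nhds hx] with y hy using pd_comm (hu y hy) j i
  · unfold wdir
    rw [Lop_sum _ h2, Finset.sum_congr rfl fun k _ => Lop_sum _ (h1 k)]
    simp only [Lop_const_mul hK ((hux.pdiff _).pdiff _), Lop_pd2 hΩ hu hpd heq hx, AM]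
    simp only [Matrix.mul_sum, Matrix.sum_mul, Matrix.trace_sum, Matrix.smul_mul, Matrix.mul_smul,
      Matrix.trace_smul, smul_eq_mul, Finset.mul_sum]
    rw [Finset.sum_comm]
    exact Finset.sum_congr rfl fun k _ => Finset.sum_congr rfl fun l _ => by ring

end pde2

section algebra
open Matrix
variable {n : ℕ} {K A : Matrix (Fin n) (Fin n) ℝ} {e : Fin n → ℝ} {lam : ℝ}

lemma trace_sq_nonneg (hK : K.PosSemidef) {B : Matrix (Fin n) (Fin n) ℝ} (hB : Bᵀ = B) :
    0 ≤ (K * B * K * B).trace := by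
  obtain ⟨D, rfl⟩ := psd_factor hK
  have h1 : (Dᵀ * D * B * (Dᵀ * D) * B).trace = ((D * B * Dᵀ)ᵀ * (D * B * Dᵀ)).trace := by
    have : (D * B * Dᵀ)ᵀ = D * B * Dᵀ := by
      simp [Matrix.transpose_mul, hB, Matrix.mul_assoc]
    rw [this]
    have e1 : Dᵀ * D * B * (Dᵀ * D) * B = Dᵀ * (D * B * Dᵀ * D * B) := by
      simp only [Matrix.mul_assoc]
    rw [e1, Matrix.trace_mul_comm]
    simp only [Matrix.mul_assoc]
  rw [h1]
  have := (posSemidef_conjTranspose_mul_self (D * B * Dᵀ)).trace_nonneg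
  simpa using this

/-- auxiliary rank two matrix -/
def SM (v e : Fin n → ℝ) : Matrix (Fin n) (Fin n) ℝ :=
  vecMulVec v e + vecMulVec e v - (v ⬝ᵥ e) • vecMulVec e e

lemma dot_sym {M : Matrix (Fin n) (Fin n) ℝ} (hM : Mᵀ = M) (a b : Fin n → ℝ) :
    (M *ᵥ a) ⬝ᵥ b = a ⬝ᵥ (M *ᵥ b) := by
  rw [dotProduct_comm, dotProduct_mulVec, ← mulVec_transpose, hM, dotProduct_comm]

lemma trace_SM (hKs : Kᵀ = K) (hKe : K *ᵥ e = lam⁻¹ • e) {X : Matrix (Fin n) (Fin n) ℝ}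
    (hX : Xᵀ = X) {v : Fin n → ℝ} (hv : X *ᵥ e = v) :
    (K * X * K * SM v e).trace = 2 * ip K v v / lam - (v ⬝ᵥ e) ^ 2 / lam ^ 2 := by
  have h1 : ∀ a b : Fin n → ℝ, (K * X * K * vecMulVec a b).trace = (X *ᵥ (K *ᵥ a)) ⬝ᵥ (K *ᵥ b) := by
    intro a b
    rw [mul_vecMulVec, trace_vecMulVec, ← mulVec_mulVec, ← mulVec_mulVec, dot_sym hKs]
  have h2 : (X *ᵥ (K *ᵥ v)) ⬝ᵥ e = ip K v v := by
    rw [dot_sym hX, hv, dotProduct_comm, ip]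
  simp only [SM, Matrix.mul_sub, Matrix.mul_add, Matrix.mul_smul, trace_add, trace_sub, trace_smul,
    h1, hKe, mulVec_smul, hv, dotProduct_smul, smul_dotProduct, h2, smul_eq_mul]
  rw [show v ⬝ᵥ (K *ᵥ v) = ip K v v from rfl]
  ring

lemma SM_sym (v e : Fin n → ℝ) : (SM v e)ᵀ = SM v e := by
  simp only [SM, transpose_sub, transpose_add, transpose_smul, transpose_vecMulVec]
  rw [add_comm]

lemma SM_e (he : e ⬝ᵥ e = 1) (v : Fin n → ℝ) : SM v e *ᵥ e = v := by
  funext i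
  simp only [SM, sub_mulVec, add_mulVec, smul_mulVec, vecMulVec_mulVec, he]
  simp

lemma trace_ineq (hK : K.PosSemidef) (hKs : Kᵀ = K) (hKe : K *ᵥ e = lam⁻¹ • e) (he : e ⬝ᵥ e = 1)
    (hA : Aᵀ = A) {v : Fin n → ℝ} (hv : A *ᵥ e = v) :
    2 * ip K v v / lam - (v ⬝ᵥ e) ^ 2 / lam ^ 2 ≤ (K * A * K * A).trace := by
  have h1 := trace_SM hKs hKe hA hv
  have h2 := trace_SM hKs hKe (SM_sym v e) (SM_e he v)
  have h3 : (K * SM v e * K * A).trace = (K * A * K * SM v e).trace := by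
    rw [Matrix.mul_assoc (K * SM v e), Matrix.trace_mul_comm, ← Matrix.mul_assoc]
  have h4 := trace_sq_nonneg hK (B := A - SM v e) (by rw [transpose_sub, hA, SM_sym])
  simp only [Matrix.mul_sub, Matrix.sub_mul, trace_sub] at h4
  linarith

lemma ip_nonneg (hK : K.PosSemidef) (a : Fin n → ℝ) : 0 ≤ ip K a a := by
  have := hK.dotProduct_mulVec_nonneg a
  simpa [ip] using this

lemma ip_add_left (a b c : Fin n → ℝ) : ip K (a + b) c = ip K a c + ip K b c := by
  simp [ip, add_dotProduct]
lemma ip_add_right (a b c : Fin n → ℝ) : ip K c (a + b) = ip K c a + ip K c b := by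
  simp [ip, mulVec_add, dotProduct_add]
lemma ip_sub_left (a b c : Fin n → ℝ) : ip K (a - b) c = ip K a c - ip K b c := by
  simp [ip, sub_dotProduct]
lemma ip_sub_right (a b c : Fin n → ℝ) : ip K c (a - b) = ip K c a - ip K c b := by
  simp [ip, mulVec_sub, dotProduct_sub]
lemma ip_smul_left (a b : Fin n → ℝ) (c : ℝ) : ip K (c • a) b = c * ip K a b := by
  simp [ip]

/-- component orthogonal to `e` -/
def pj (e a : Fin n → ℝ) : Fin n → ℝ := a - (a ⬝ᵥ e) • e

lemma ip_pj (hKs : Kᵀ = K) (hKe : K *ᵥ e = lam⁻¹ • e) (he : e ⬝ᵥ e = 1) (a : Fin n → ℝ) :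
    ip K (pj e a) (pj e a) = ip K a a - (a ⬝ᵥ e) ^ 2 / lam := by
  have h1 : ∀ b, ip K b e = lam⁻¹ * (b ⬝ᵥ e) := by
    intro b; rw [ip, hKe, dotProduct_smul, smul_eq_mul]
  have h2 : ∀ b, ip K e b = lam⁻¹ * (b ⬝ᵥ e) := by
    intro b; rw [ip_comm hKs, h1]
  simp only [pj, ip_sub_left, ip_sub_right, ip_smul_left, ip_smul_right, h1, h2, he,
    sub_dotProduct, smul_dotProduct, smul_eq_mul]
  ring

lemma pj_add (a b : Fin n → ℝ) : pj e (a + b) = pj e a + pj e b := by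
  simp only [pj, add_dotProduct, add_smul]; abel

lemma pj_smul (c : ℝ) (a : Fin n → ℝ) : pj e (c • a) = c • pj e a := by
  simp only [pj, smul_dotProduct, smul_sub, smul_smul, smul_eq_mul]

lemma ip_four (hK : K.PosSemidef) (hKs : Kᵀ = K) (a b c d : Fin n → ℝ) :
    ip K (a + b + c + d) (a + b + c + d)
      ≤ 4 * (ip K a a + ip K b b + ip K c c + ip K d d) := by
  have h1 := ip_nonneg hK (a - b)
  have h2 := ip_nonneg hK (a - c)
  have h3 := ip_nonneg hK (a - d)
  have h4 := ip_nonneg hK (b - c)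
  have h5 := ip_nonneg hK (b - d)
  have h6 := ip_nonneg hK (c - d)
  simp only [ip_sub_left, ip_sub_right, ip_add_left, ip_add_right] at *
  rw [ip_comm hKs b a, ip_comm hKs c a, ip_comm hKs c b, ip_comm hKs d a, ip_comm hKs d b,
    ip_comm hKs d c] at *
  linarith

lemma ip_amgm (hK : K.PosSemidef) (hKs : Kᵀ = K) (a b : Fin n → ℝ) {t : ℝ} (ht : 0 < t) :
    2 * ip K a b ≤ t * ip K a a + ip K b b / t := by
  have h1 := ip_nonneg hK (t • a - b)
  simp only [ip_sub_left, ip_sub_right, ip_smul_left, ip_smul_right] at h1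
  rw [ip_comm hKs b a] at h1
  have : t * ip K a a + ip K b b / t - 2 * ip K a b
      = (t * (t * ip K a a - ip K a b) - (t * ip K a b - ip K b b)) / t := by
    field_simp; ring
  have h2 := div_nonneg h1 ht.le
  linarith

lemma trace_ge {H : Matrix (Fin n) (Fin n) ℝ} (hH : H.PosSemidef) (he : e ⬝ᵥ e = 1) :
    ip H e e ≤ H.trace := by
  obtain ⟨D, rfl⟩ := psd_factor hH
  have h1 : ip (Dᵀ * D) e e = ∑ k, (∑ i, D k i * e i) ^ 2 := by
    rw [ip, ← mulVec_mulVec, dotProduct_mulVec, vecMul_transpose]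
    simp [dotProduct, mulVec, pow_two]
  have h2 : (Dᵀ * D).trace = ∑ k, ∑ i, (D k i) ^ 2 := by
    rw [trace_mul_comm]
    simp [trace, Matrix.mul_apply, pow_two]
  rw [h1, h2]
  refine Finset.sum_le_sum fun k _ => ?_
  refine (Finset.sum_mul_sq_le_sq_mul_sq _ _ _).trans ?_
  have : ∑ i, e i ^ 2 = 1 := by rw [← he]; simp [dotProduct, pow_two]
  rw [this, mul_one]

end algebra

section keyvec
open Matrix
variable {n : ℕ} {K : Matrix (Fin n) (Fin n) ℝ} {e : Fin n → ℝ} {lam : ℝ}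

lemma ip_two (hK : K.PosSemidef) (hKs : Kᵀ = K) (a b : Fin n → ℝ) :
    ip K (a + b) (a + b) ≤ 2 * (ip K a a + ip K b b) := by
  have h1 := ip_nonneg hK (a - b)
  simp only [ip_sub_left, ip_sub_right, ip_add_left, ip_add_right] at *
  rw [ip_comm hKs b a] at *
  linarith

lemma ip_smul_smul (a : Fin n → ℝ) (c : ℝ) : ip K (c • a) (c • a) = c ^ 2 * ip K a a := by
  rw [ip_smul_left, ip_smul_right]; ring

lemma key_vec (hK : K.PosSemidef) (hKs : Kᵀ = K) (hlam : 0 < lam)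
    (hKe : K *ᵥ e = lam⁻¹ • e) (he : e ⬝ᵥ e = 1)
    (a r v y z : Fin n → ℝ) {s E P N α q ε b nn Lw T : ℝ}
    (hN : 64 ≤ N) (hNq : 32 * q ≤ N) (hq : 2 ≤ q) (hb : 1 ≤ b) (hε : ε = 1 / (20 * b))
    (hE : 0 < E) (hs : 0 < s) (hnn : 0 ≤ nn)
    (hZ : ip K z z ≤ 4 * lam * P) (hP0 : 0 ≤ P) (hP : P ≤ b * E ^ 2) (hae : (a ⬝ᵥ e) ^ 2 ≤ P)
    (hT : lam ≤ T) (hLw : 2 * ip K v v / lam - (v ⬝ᵥ e) ^ 2 / lam ^ 2 ≤ Lw)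
    (hgrad : (N / s) • a = α • r + lam⁻¹ • v + (-(q / E)) • y
      + ε • ((E ^ 2)⁻¹ • z + (-(2 * P / E ^ 3)) • y))
    (hL : N * (-(nn - (nn + 2) * ip K r a) / s - ip K a a / s ^ 2)
      + (Lw / lam - ip K v v / lam ^ 2) - q * (nn / E - ip K y y / E ^ 2)
      + ε * (2 * T / E ^ 2 - 4 / E ^ 3 * ip K z y
        + P * (-2 / E ^ 3 * nn + 6 / E ^ 4 * ip K y y)) ≤ 0) :
    ε * lam / (2 * E ^ 2) ≤ N * nn / s + (N * (nn + 2) ^ 2 + α ^ 2) * ip K r r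
      + 2 * N * b * E ^ 2 / (lam * s ^ 2) + (q + 2) * nn / E := by
  have hb0 : 0 < b := by linarith
  have hε0 : 0 < ε := by rw [hε]; positivity
  have hεb : ε * b = 1 / 20 := by rw [hε]; field_simp
  have hN0 : 0 < N := by linarith
  have hY := ip_nonneg hK y
  have hΦ := ip_nonneg hK r
  set Y := ip K y y with hYdef
  set Φ := ip K r r with hΦdef
  set X := lam / E ^ 2 with hX
  set Y1 := Y / E ^ 2 with hY1
  have hX0 : 0 < X := by positivity
  have hY10 : 0 ≤ Y1 := by positivity
  -- orthogonal parts
  set Ap := ip K (pj e a) (pj e a) with hAp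
  set Vp := ip K (pj e v) (pj e v) with hVp
  have eA := ip_pj hKs hKe he a
  have eV := ip_pj hKs hKe he v
  have pjle : ∀ c, ip K (pj e c) (pj e c) ≤ ip K c c := by
    intro c
    rw [ip_pj hKs hKe he c]
    have : 0 ≤ (c ⬝ᵥ e) ^ 2 / lam := by positivity
    linarith
  have hVp0 : 0 ≤ Vp := ip_nonneg hK _
  have hAp0 : 0 ≤ Ap := ip_nonneg hK _
  -- step 1
  have s1 : Vp / lam ^ 2 ≤ Lw / lam - ip K v v / lam ^ 2 := by
    have h1 : (2 * ip K v v / lam - (v ⬝ᵥ e) ^ 2 / lam ^ 2) / lam ≤ Lw / lam := by gcongr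
    have h2 : (2 * ip K v v / lam - (v ⬝ᵥ e) ^ 2 / lam ^ 2) / lam
        = Vp / lam ^ 2 + ip K v v / lam ^ 2 := by
      rw [hVp, eV]; field_simp; ring
    linarith
  -- step 2
  have s2 : 2 * X ≤ 2 * T / E ^ 2 := by
    rw [hX, ← mul_div_assoc]; gcongr
  -- step 3
  have s3 : 4 / E ^ 3 * ip K z y ≤ X + 16 * b * Y1 := by
    have h1 := ip_amgm hK hKs z y (t := 1 / (8 * b * E)) (by positivity)
    have h2 : 1 / (8 * b * E) * ip K z z ≤ 1 / (8 * b * E) * (4 * lam * (b * E ^ 2)) := by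
      apply mul_le_mul_of_nonneg_left _ (by positivity)
      refine hZ.trans ?_
      gcongr
    have h3 : 4 / E ^ 3 * ip K z y = 2 / E ^ 3 * (2 * ip K z y) := by ring
    rw [h3]
    calc 2 / E ^ 3 * (2 * ip K z y)
        ≤ 2 / E ^ 3 * (1 / (8 * b * E) * (4 * lam * (b * E ^ 2)) + Y / (1 / (8 * b * E))) := by
          apply mul_le_mul_of_nonneg_left _ (by positivity)
          linarith
      _ = X + 16 * b * Y1 := by
          rw [hX, hY1]; field_simp; ring
  -- step 4
  have s4 : -(2 * b * nn / E) ≤ P * (-2 / E ^ 3 * nn + 6 / E ^ 4 * Y) := by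
    have h1 : 0 ≤ P * (6 / E ^ 4 * Y) := by positivity
    have h2 : P * (2 / E ^ 3 * nn) ≤ (b * E ^ 2) * (2 / E ^ 3 * nn) := by gcongr
    have h3 : (b * E ^ 2) * (2 / E ^ 3 * nn) = 2 * b * nn / E := by field_simp
    have h4 : P * (-2 / E ^ 3 * nn + 6 / E ^ 4 * Y)
      = P * (6 / E ^ 4 * Y) - P * (2 / E ^ 3 * nn) := by ring
    linarith
  -- step 5
  have s5 : -(2 * ((nn + 2) * ip K r a / s)) ≤ (nn + 2) ^ 2 * Φ + ip K a a / s ^ 2 := by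
    have h1 := ip_amgm hK hKs (-(nn + 2) • r) (s⁻¹ • a) (t := 1) one_pos
    rw [ip_smul_smul, ip_smul_smul, ip_smul_left, ip_smul_right] at h1
    have h2 : ip K a a / s ^ 2 = (s⁻¹) ^ 2 * ip K a a := by field_simp
    have h3 : (nn + 2) * ip K r a / s = (nn + 2) * (s⁻¹ * ip K r a) := by field_simp
    rw [h2, h3]
    linarith
  -- step 6
  have s6 : ip K a a / s ^ 2 ≤ Ap / s ^ 2 + b * E ^ 2 / (lam * s ^ 2) := by
    have h1 : ip K a a = Ap + (a ⬝ᵥ e) ^ 2 / lam := by rw [hAp, eA]; ring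
    have h2 : (a ⬝ᵥ e) ^ 2 / lam ≤ b * E ^ 2 / lam := by gcongr; linarith
    have h3 : ip K a a / s ^ 2 ≤ (Ap + b * E ^ 2 / lam) / s ^ 2 := by
      rw [h1]; gcongr
    refine h3.trans_eq ?_
    field_simp
  -- step 7
  have s7 : N ^ 2 * (Ap / s ^ 2) ≤ 4 * (α ^ 2 * Φ + Vp / lam ^ 2 + q ^ 2 * Y1
      + ε ^ 2 * (8 * b * X + 8 * b ^ 2 * Y1)) := by
    have h1 : N ^ 2 * (Ap / s ^ 2) = ip K (pj e ((N / s) • a)) (pj e ((N / s) • a)) := by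
      rw [pj_smul, ip_smul_smul]; ring
    rw [h1, hgrad, pj_add, pj_add, pj_add]
    refine (ip_four hK hKs _ _ _ _).trans ?_
    have k1 : ip K (pj e (α • r)) (pj e (α • r)) ≤ α ^ 2 * Φ := by
      refine (pjle _).trans ?_
      rw [ip_smul_smul]
    have k2 : ip K (pj e (lam⁻¹ • v)) (pj e (lam⁻¹ • v)) = Vp / lam ^ 2 := by
      rw [pj_smul, ip_smul_smul, hVp]; field_simp
    have k3 : ip K (pj e (-(q / E) • y)) (pj e (-(q / E) • y)) ≤ q ^ 2 * Y1 := by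
      refine (pjle _).trans ?_
      rw [ip_smul_smul, hY1]; apply le_of_eq; field_simp; rfl
    have k4 : ip K (pj e (ε • ((E ^ 2)⁻¹ • z + -(2 * P / E ^ 3) • y)))
        (pj e (ε • ((E ^ 2)⁻¹ • z + -(2 * P / E ^ 3) • y)))
        ≤ ε ^ 2 * (8 * b * X + 8 * b ^ 2 * Y1) := by
      refine (pjle _).trans ?_
      rw [ip_smul_smul]
      apply mul_le_mul_of_nonneg_left _ (by positivity)
      refine (ip_two hK hKs _ _).trans ?_
      rw [ip_smul_smul, ip_smul_smul]
      have j1 : ((E ^ 2)⁻¹) ^ 2 * ip K z z ≤ ((E ^ 2)⁻¹) ^ 2 * (4 * lam * (b * E ^ 2)) := by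
        apply mul_le_mul_of_nonneg_left _ (by positivity)
        refine hZ.trans ?_
        gcongr
      have j2 : ((E ^ 2)⁻¹) ^ 2 * (4 * lam * (b * E ^ 2)) = 4 * b * X := by
        rw [hX]; field_simp
      have j3 : (-(2 * P / E ^ 3)) ^ 2 * Y ≤ (2 * (b * E ^ 2) / E ^ 3) ^ 2 * Y := by
        rw [neg_sq]; gcongr
      have j4 : (2 * (b * E ^ 2) / E ^ 3) ^ 2 * Y = 4 * b ^ 2 * Y1 := by
        rw [hY1]; field_simp; ring
      linarith
    linarith
  -- collect
  have c1 : N * (Ap / s ^ 2) ≤ (α ^ 2 * Φ) / 16 + (Vp / lam ^ 2) / 16 + q * Y1 / 8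
      + (ε * X / 40 + Y1 / 100) := by
    have h1 : N * (Ap / s ^ 2) = (N ^ 2 * (Ap / s ^ 2)) / N := by field_simp
    rw [h1, div_le_iff₀ hN0]
    refine s7.trans ?_
    have e1 : ε ^ 2 * (8 * b * X + 8 * b ^ 2 * Y1) = (ε * b) * 8 * (ε * X) + 8 * (ε * b) ^ 2 * Y1 := by
      ring
    rw [e1, hεb]
    have t1 : 0 ≤ α ^ 2 * Φ := by positivity
    have t2 : 0 ≤ Vp / lam ^ 2 := by positivity
    have t3 : 0 ≤ ε * X := by positivity
    have t4 : 0 ≤ q * Y1 := by positivity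
    have m1 := mul_le_mul_of_nonneg_left hN t1
    have m2 := mul_le_mul_of_nonneg_left hN t2
    have m3 := mul_le_mul_of_nonneg_left hN t3
    have m4 := mul_le_mul_of_nonneg_left hNq t4
    have m5 := mul_le_mul_of_nonneg_left hN hY10
    have e2 : q ^ 2 * Y1 = q * Y1 * q := by ring
    rw [e2]
    linarith
  have w1 : N * (-(nn - (nn + 2) * ip K r a) / s - ip K a a / s ^ 2)
      = -(N * nn / s) + N * ((nn + 2) * ip K r a / s) - N * (ip K a a / s ^ 2) := by
    field_simp; ring
  have w2 : q * (nn / E - Y / E ^ 2) = q * nn / E - q * Y1 := by rw [hY1]; ring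
  rw [w1, w2] at hL
  have w3 := mul_le_mul_of_nonneg_left s5 hN0.le
  have w4 := mul_le_mul_of_nonneg_left s6 hN0.le
  have w5 : ε * (2 * X - (X + 16 * b * Y1) + -(2 * b * nn / E))
      ≤ ε * (2 * T / E ^ 2 - 4 / E ^ 3 * ip K z y + P * (-2 / E ^ 3 * nn + 6 / E ^ 4 * Y)) := by
    apply mul_le_mul_of_nonneg_left _ hε0.le
    linarith
  have w6 : ε * (2 * X - (X + 16 * b * Y1) + -(2 * b * nn / E))
      = ε * X - 16 * (ε * b) * Y1 - 2 * (ε * b) * (nn / E) := by ring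
  rw [w6, hεb] at w5
  have g1 : ε * lam / (2 * E ^ 2) = ε * X / 2 := by rw [hX]; field_simp
  have g2 : 2 * N * b * E ^ 2 / (lam * s ^ 2) = 2 * (N * (b * E ^ 2 / (lam * s ^ 2))) := by ring
  have g3 : (q + 2) * nn / E = q * nn / E + 2 * (nn / E) := by ring
  rw [g1, g2, g3]
  have p1 : 0 ≤ nn / E := by positivity
  have p2 : 0 ≤ N * (b * E ^ 2 / (lam * s ^ 2)) := by positivity
  have p3 : 0 ≤ N * ((nn + 2) ^ 2 * Φ) := by positivity
  have p4 : 0 ≤ α ^ 2 * Φ := by positivity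
  have p5 : 0 ≤ Vp / lam ^ 2 := by positivity
  have p6 : 2 * Y1 ≤ q * Y1 := by gcongr
  have p7 : 0 ≤ ε * X := by positivity
  have g4 : (N * (nn + 2) ^ 2 + α ^ 2) * Φ = N * ((nn + 2) ^ 2 * Φ) + α ^ 2 * Φ := by ring
  rw [g4]
  linarith

set_option maxHeartbeats 1000000 in
/-- scalar conclusion -/
lemma key_scalar {s E lam R Φ N α q ε b nn : ℝ} {k : ℕ} (hk : 2 ≤ k) (hN : N = k) (hq : 2 ≤ q)
    (hb : 1 ≤ b) (hε : ε = 1 / (20 * b)) (hE : 0 < E) (hs : 0 < s) (hs1 : s ≤ 1)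
    (hsE : s ≤ 2 * E) (hlam : 0 < lam) (hnn : 0 ≤ nn)
    (hR0 : 0 < R) (hR : R ≤ b) (hΦ : 0 ≤ Φ) (hRΦ : R * Φ ≤ b)
    (h : ε * lam / (2 * E ^ 2) ≤ N * nn / s + (N * (nn + 2) ^ 2 + α ^ 2) * Φ
      + 2 * N * b * E ^ 2 / (lam * s ^ 2) + (q + 2) * nn / E) :
    s ^ k * R * (lam / E ^ 2)
      ≤ b + 3 * b * (40 * b * (N * nn + 2 * (q + 2) * nn + (N * (nn + 2) ^ 2 + α ^ 2) + 2 * N * b)) := by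
  set X := lam / E ^ 2 with hX
  have hX0 : 0 < X := by positivity
  have hN0 : 0 ≤ N := by rw [hN]; positivity
  set A1 := N * nn + 2 * (q + 2) * nn with hA1
  set A2 := N * (nn + 2) ^ 2 + α ^ 2 with hA2
  set A3 := 2 * N * b with hA3
  have hA10 : 0 ≤ A1 := by positivity
  have hA20 : 0 ≤ A2 := by positivity
  have hA30 : 0 ≤ A3 := by positivity
  have h1 : X ≤ 40 * b * (A1 / s + A2 * Φ + A3 / (X * s ^ 2)) := by
    have e1 : ε * lam / (2 * E ^ 2) = X / (40 * b) := by rw [hX, hε]; field_simp; ring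
    have e2 : 2 * N * b * E ^ 2 / (lam * s ^ 2) = A3 / (X * s ^ 2) := by
      rw [hX, hA3]; field_simp
    have e3 : (q + 2) * nn / E ≤ 2 * (q + 2) * nn / s := by
      rw [div_le_div_iff₀ hE hs]
      have : 0 ≤ (q + 2) * nn := by positivity
      nlinarith [mul_le_mul_of_nonneg_left hsE this]
    have e4 : A1 / s = N * nn / s + 2 * (q + 2) * nn / s := by rw [hA1]; ring
    rw [e1, e2] at h
    rw [e4]
    have : X / (40 * b) ≤ N * nn / s + 2 * (q + 2) * nn / s + A2 * Φ + A3 / (X * s ^ 2) := by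
      linarith
    rw [div_le_iff₀ (by positivity)] at this
    linarith
  set W := s ^ k * R * X with hW
  have hW0 : 0 < W := by positivity
  set D := 40 * b * (A1 + A2 + A3) with hD
  -- multiply out
  have h2 : W ^ 2 ≤ D * (2 * b * W + b ^ 2) := by
    have f1 : W ^ 2 = (s ^ (2 * k) * R ^ 2 * X) * X := by rw [hW]; ring
    have f2 : W ^ 2 ≤ (s ^ (2 * k) * R ^ 2 * X) * (40 * b * (A1 / s + A2 * Φ + A3 / (X * s ^ 2))) := by
      rw [f1]; gcongr
    obtain ⟨m, rfl⟩ : ∃ m, k = m + 2 := ⟨k - 2, by omega⟩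
    have sm : ∀ j : ℕ, s ^ j ≤ 1 := fun j => pow_le_one₀ hs.le hs1
    have f3 : (s ^ (2 * (m + 2)) * R ^ 2 * X) * (40 * b * (A1 / s + A2 * Φ + A3 / (X * s ^ 2)))
        = 40 * b * (A1 * (W * (s ^ (m + 1) * R)) + A2 * (W * (s ^ (m + 2) * (R * Φ)))
          + A3 * (s ^ (2 * m + 2) * R ^ 2)) := by
      rw [hW]; field_simp; ring
    have f4 : s ^ (m + 1) * R ≤ 1 * b := by gcongr; exact sm _
    have f5 : s ^ (m + 2) * (R * Φ) ≤ 1 * b := by gcongr; exact sm _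
    have f6 : s ^ (2 * m + 2) * R ^ 2 ≤ 1 * b ^ 2 := by gcongr; exact sm _
    rw [f3] at f2
    refine f2.trans ?_
    have f7 : 40 * b * (A1 * (W * (s ^ (m + 1) * R)) + A2 * (W * (s ^ (m + 2) * (R * Φ)))
          + A3 * (s ^ (2 * m + 2) * R ^ 2)) ≤ 40 * b * (A1 * (W * (1 * b)) + A2 * (W * (1 * b))
          + A3 * (1 * b ^ 2)) := by gcongr
    refine f7.trans ?_
    rw [hD, mul_assoc (40 * b)]
    apply mul_le_mul_of_nonneg_left _ (by positivity)
    have g1 : 0 ≤ A1 * (W * b) := by positivity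
    have g2 : 0 ≤ A2 * (W * b) := by positivity
    have g3 : 0 ≤ A3 * (W * b) := by positivity
    have g4 : 0 ≤ A1 * b ^ 2 := by positivity
    have g5 : 0 ≤ A2 * b ^ 2 := by positivity
    have g6 : (A1 + A2 + A3) * (2 * b * W + b ^ 2)
        = A1 * (W * (1 * b)) + A2 * (W * (1 * b)) + A3 * (1 * b ^ 2)
          + (A1 * (W * b) + A2 * (W * b) + 2 * (A3 * (W * b)) + A1 * b ^ 2 + A2 * b ^ 2) := by ring
    rw [g6]
    linarith
  have hD0 : 0 ≤ D := by positivity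
  by_contra hcon
  push Not at hcon
  have hcon' : b + 3 * b * D < W := hcon
  have hWb : b < W := by
    have : 0 ≤ 3 * b * D := by positivity
    linarith
  have i1 : D * (2 * b * W + b ^ 2) ≤ D * (3 * b * W) := by
    apply mul_le_mul_of_nonneg_left _ hD0
    have : b * b ≤ b * W := mul_le_mul_of_nonneg_left hWb.le (by linarith)
    linarith
  have i2 : (b + 3 * b * D) * W < W * W := mul_lt_mul_of_pos_right hcon' hW0
  have i3 : 0 < b * W := by positivity
  have i4 : (b + 3 * b * D) * W = b * W + D * (3 * b * W) := by ring
  have i5 : W ^ 2 = W * W := by ring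
  linarith

end keyvec

section keypoint
open Matrix
variable {n : ℕ} {Ω : Set (Fin n → ℝ)} {u : (Fin n → ℝ) → ℝ} {dv : Fin n → ℝ} {d0 : ℝ}
  {x : Fin n → ℝ}

lemma ip_smul_both (H : Matrix (Fin n) (Fin n) ℝ) (a : Fin n → ℝ) (c : ℝ) :
    ip H (c • a) (c • a) = c ^ 2 * ip H a a := ip_smul_smul a c

lemma dot_self_pos {a : Fin n → ℝ} (ha : a ≠ 0) : 0 < a ⬝ᵥ a := by
  have h1 : 0 ≤ a ⬝ᵥ a := Finset.sum_nonneg fun i _ => mul_self_nonneg _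
  exact lt_of_le_of_ne h1 fun h => ha (dotProduct_self_eq_zero.1 h.symm)

lemma ip_pos {H : Matrix (Fin n) (Fin n) ℝ} (hH : H.PosDef) {a : Fin n → ℝ} (ha : a ≠ 0) :
    0 < ip H a a := by
  have := hH.dotProduct_mulVec_pos ha
  simpa [ip] using this

lemma eigen_max {H : Matrix (Fin n) (Fin n) ℝ} (hH : H.PosDef) {e : Fin n → ℝ}
    (he : e ⬝ᵥ e = 1) (hmax : ∀ a : Fin n → ℝ, a ⬝ᵥ a = 1 → ip H a a ≤ ip H e e) :
    (∀ a, ip H a a ≤ ip H e e * (a ⬝ᵥ a)) ∧ H *ᵥ e = ip H e e • e := by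
  have hle : ∀ a, ip H a a ≤ ip H e e * (a ⬝ᵥ a) := by
    intro a
    by_cases ha : a = 0
    · subst ha; simp [ip]
    have hp := dot_self_pos ha
    set t := Real.sqrt (a ⬝ᵥ a) with ht
    have ht0 : 0 < t := Real.sqrt_pos.2 hp
    have ht2 : t ^ 2 = a ⬝ᵥ a := Real.sq_sqrt hp.le
    have h1 := hmax (t⁻¹ • a) (by
      rw [smul_dotProduct, dotProduct_smul, smul_eq_mul, smul_eq_mul, ← ht2]; field_simp)
    rw [ip_smul_both, inv_pow, ht2, inv_mul_le_iff₀ hp] at h1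
    linarith
  refine ⟨hle, ?_⟩
  set lam := ip H e e with hlam
  have hsym : Hᵀ = H := by simpa using hH.1.eq
  have hpsd : (lam • (1 : Matrix (Fin n) (Fin n) ℝ) - H).PosSemidef := by
    refine PosSemidef.of_dotProduct_mulVec_nonneg ?_ ?_
    · simp [IsHermitian, hsym]
    · intro a
      have := hle a
      simp only [ip] at this
      simp only [star_trivial, sub_mulVec, smul_mulVec, one_mulVec, dotProduct_sub,
        dotProduct_smul, smul_eq_mul]
      linarith
  have h0 : (lam • (1 : Matrix (Fin n) (Fin n) ℝ) - H) *ᵥ e = 0 := by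
    apply (hpsd.dotProduct_mulVec_zero_iff e).1
    simp only [star_trivial, sub_mulVec, smul_mulVec, one_mulVec, dotProduct_sub,
        dotProduct_smul, smul_eq_mul, he]
    rw [hlam, ip]; ring
  rw [sub_mulVec, smul_mulVec, one_mulVec] at h0
  exact (sub_eq_zero.1 h0).symm

lemma key_point (hΩ : IsOpen Ω) (hu : ∀ y ∈ Ω, Sm u y)
    (hpd : ∀ y ∈ Ω, (hess u y).PosDef)
    (heq : ∀ ξ ∈ Ω, (hess u ξ).det = Real.exp (-(∑ i : Fin n, dv i * pd i u ξ) - d0))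
    (hx : x ∈ Ω) {C d N α q ε b : ℝ} {e : Fin n → ℝ}
    (hN : 64 ≤ N) (hNq : 32 * q ≤ N) (hq : 2 ≤ q) (hb : 1 ≤ b) (hε : ε = 1 / (20 * b))
    (hs : 0 < C - u x) (hE : 0 < d + legendreF u x)
    (he : e ⬝ᵥ e = 1)
    (hmax : ∀ a : Fin n → ℝ, a ⬝ᵥ a = 1 → ip (hess u x) a a ≤ ip (hess u x) e e)
    (hP : ∑ k, (pd k u x) ^ 2 ≤ b * (d + legendreF u x) ^ 2)
    (hm : IsLocalMax (phiT N α q ε (fun y => C - u y) (lrho n u dv d0) (wdir u e)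
      (fun y => d + legendreF u y) (fun y => ∑ k, (pd k u y) ^ 2)) x) :
    ε * ip (hess u x) e e / (2 * (d + legendreF u x) ^ 2)
      ≤ N * n / (C - u x) + (N * ((n : ℝ) + 2) ^ 2 + α ^ 2) * PhiU u x
      + 2 * N * b * (d + legendreF u x) ^ 2 / (ip (hess u x) e e * (C - u x) ^ 2)
      + (q + 2) * n / (d + legendreF u x) := by
  have hux := hu x hx
  have hH := hpd x hx
  have hdet : IsUnit (hess u x).det := isUnit_iff_ne_zero.2 hH.det_pos.ne'
  have hKs := hess_inv_symm hux
  have hKpsd : ((hess u x)⁻¹).PosSemidef := hH.inv.posSemidef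
  obtain ⟨hle, hHe⟩ := eigen_max hH he hmax
  have he0 : e ≠ 0 := by rintro rfl; simp at he
  have hlam : 0 < ip (hess u x) e e := ip_pos hH he0
  obtain ⟨hwS, hwv, hwg, hAs, hwL⟩ := w_id hΩ hu hpd heq hx e
  obtain ⟨hPS, hPg, hPL⟩ := P_id hΩ hu hpd heq hx
  obtain ⟨hlS, -, hlL, -⟩ := l_id hΩ hu hpd heq hx
  have hES : Sm (fun y => d + legendreF u y) x := contDiffAt_const.add (Sm_leg hux)
  have hEL := leg_id hΩ hu hpd heq hx d
  have huL := Lop_u' hΩ hu hpd heq hx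
  have hsS : Sm (fun y => C - u y) x := contDiffAt_const.sub hux
  have hsg : gr (fun y => C - u y) x = -gr u x := by
    funext i
    rw [gr, pd_sub (differentiableAt_const C) hux.diff, pd_const]
    simp [gr]
  have hsL : Lop (hess u x)⁻¹ dv (fun y => C - u y) x = - Lop (hess u x)⁻¹ dv u x := by
    have h1 : (fun y => C - u y) = fun y => (fun _ : Fin n → ℝ => C) y + (fun y => (-1) * u y) y := by
      funext y; ring
    have h2 : Sm (fun y => (-1) * u y) x := contDiffAt_const.mul hux
    rw [h1, Lop_add contDiffAt_const h2, Lop_const, Lop_const_mul hKs hux]; ring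
  obtain ⟨fS, fg, fL⟩ := phiT_calc (dv := dv) (N := N) (α := α) (q := q) (ε := ε) hKs hsS hlS hwS hES hPS
    hs (by rw [hwv]; exact hlam) hE
  have hgr0 := max_grad hm
  have hLle := max_trace fS hm hKpsd
  have hLop : Lop (hess u x)⁻¹ dv (phiT N α q ε (fun y => C - u y) (lrho n u dv d0) (wdir u e)
      (fun y => d + legendreF u y) (fun y => ∑ k, (pd k u y) ^ 2)) x ≤ 0 := by
    rw [Lop]
    simp only [hgr0, mul_zero, Finset.sum_const_zero, add_zero]
    exact hLle
  rw [fL, hlL, hEL, hPL, hsL, huL, hsg, hwv] at hLop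
  rw [Phi_id hΩ hu hpd heq hx]
  set lam := ip (hess u x) e e with hlamdef
  have hKe : (hess u x)⁻¹ *ᵥ e = lam⁻¹ • e := by
    have h1 : e = lam⁻¹ • (hess u x *ᵥ e) := by
      rw [hHe, smul_smul, inv_mul_cancel₀ hlam.ne', one_smul]
    conv_lhs => rw [h1]
    rw [mulVec_smul, mulVec_mulVec, nonsing_inv_mul _ hdet, one_mulVec]
  have hnegip : ip (hess u x)⁻¹ (-gr u x) (-gr u x) = ip (hess u x)⁻¹ (gr u x) (gr u x) := by
    simp [ip, mulVec_neg]
  have hPdot : gr u x ⬝ᵥ gr u x = ∑ k, (pd k u x) ^ 2 := by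
    simp [dotProduct, gr, pow_two]
  refine key_vec hKpsd hKs hlam hKe he (gr u x) (gr (lrho n u dv d0) x) (gr (wdir u e) x)
    (gr (fun y => d + legendreF u y) x) (gr (fun y => ∑ k, (pd k u y) ^ 2) x)
    (Lw := Lop (hess u x)⁻¹ dv (wdir u e) x) (T := (hess u x).trace)
    (P := ∑ k, (pd k u x) ^ 2)
    hN hNq hq hb hε hE hs (Nat.cast_nonneg n) ?_ ?_ hP ?_ ?_ ?_ ?_ ?_
  · rw [hPg, ip_smul_smul, ip, mulVec_mulVec, nonsing_inv_mul _ hdet, one_mulVec,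
      dotProduct_comm]
    have := hle (gr u x)
    rw [hPdot, ip] at this
    linarith
  · positivity
  · have h1 : (∑ i, gr u x i * e i) ^ 2 ≤ (∑ i, gr u x i ^ 2) * ∑ i, e i ^ 2 :=
      Finset.sum_mul_sq_le_sq_mul_sq _ _ _
    have h2 : ∑ i, e i ^ 2 = 1 := by rw [← he]; simp [dotProduct, pow_two]
    rw [h2, mul_one] at h1
    exact h1
  · exact trace_ge hH.posSemidef he
  · rw [hwL]
    exact trace_ineq hKpsd hKs hKe he hAs hwg.symm
  · funext i
    have h1 := hgr0 i
    rw [fg i] at h1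
    have h2 : pd i (fun y => C - u y) x = - pd i u x := congrFun hsg i
    rw [h2, hwv] at h1
    simp only [Pi.add_apply, Pi.smul_apply, smul_eq_mul, gr]
    have h3 : N / (C - u x) * pd i u x = - (N * (-pd i u x / (C - u x))) := by ring
    rw [h3]
    have h4 : lam⁻¹ * pd i (wdir u e) x = pd i (wdir u e) x / lam := by ring
    rw [h4]
    linear_combination (-1 : ℝ) * h1
  · rw [hnegip] at hLop
    have h5 : α * (0 : ℝ) = 0 := mul_zero _
    rw [h5, add_zero] at hLop
    exact hLop

end keypoint

section final
open Matrix
variable {n : ℕ} {Ω : Set (Fin n → ℝ)} {u : (Fin n → ℝ) → ℝ} {dv : Fin n → ℝ} {d0 : ℝ}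

/-- weight in the test function -/
def mF (n : ℕ) (u : (Fin n → ℝ) → ℝ) (dv : Fin n → ℝ) (d0 C d : ℝ) (k : ℕ) (α q ε : ℝ)
    (y : Fin n → ℝ) : ℝ :=
  (C - u y) ^ k * Real.exp (α * lrho n u dv d0 y) * (d + legendreF u y) ^ (-q)
    * Real.exp (ε * ((∑ i, (pd i u y) ^ 2) * ((d + legendreF u y) ^ 2)⁻¹))

lemma compact_sphere (n : ℕ) : IsCompact {e : Fin n → ℝ | e ⬝ᵥ e = 1} := by
  refine Metric.isCompact_of_isClosed_isBounded ?_ ?_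
  · exact isClosed_eq (by simp only [dotProduct]; fun_prop) continuous_const
  · refine (Metric.isBounded_closedBall (x := (0 : Fin n → ℝ)) (r := 1)).subset ?_
    intro e he
    rw [mem_closedBall_zero_iff, pi_norm_le_iff_of_nonneg zero_le_one]
    intro i
    have h1 : e i * e i ≤ 1 := by
      rw [← (show e ⬝ᵥ e = 1 from he)]
      exact Finset.single_le_sum (f := fun i => e i * e i) (fun j _ => mul_self_nonneg _)
        (Finset.mem_univ i)
    rw [Real.norm_eq_abs]
    exact abs_le_one_iff_mul_self_le_one.2 h1

lemma mF_cont {C d : ℝ} {k : ℕ} {α q ε : ℝ} {x : Fin n → ℝ} (hu : Sm u x)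
    (hl : Sm (lrho n u dv d0) x) (hE : 0 < d + legendreF u x) :
    ContinuousAt (mF n u dv d0 C d k α q ε) x := by
  have h1 : ContinuousAt u x := hu.continuousAt
  have h2 : ContinuousAt (lrho n u dv d0) x := hl.continuousAt
  have h3 : ContinuousAt (fun y => d + legendreF u y) x :=
    continuousAt_const.add (Sm_leg hu).continuousAt
  have h4 : ContinuousAt (fun y => ∑ i, (pd i u y) ^ 2) x := by
    refine tendsto_finsetSum _ fun i _ => ?_
    exact (hu.pdiff i).continuousAt.pow 2
  unfold mF
  refine ContinuousAt.mul (ContinuousAt.mul (ContinuousAt.mul ?_ ?_) ?_) ?_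
  · exact (continuousAt_const.sub h1).pow k
  · exact (continuousAt_const.mul h2).rexp
  · exact h3.rpow_const (Or.inl hE.ne')
  · exact (continuousAt_const.mul (h4.mul ((h3.pow 2).inv₀ (pow_ne_zero 2 hE.ne')))).rexp

lemma main_bound (hn : 0 < n) (hΩ : IsOpen Ω) (hu : ∀ y ∈ Ω, Sm u y)
    (hpd : ∀ y ∈ Ω, (hess u y).PosDef)
    (heq : ∀ ξ ∈ Ω, (hess u ξ).det = Real.exp (-(∑ i : Fin n, dv i * pd i u ξ) - d0))
    {C d α q ε b : ℝ} {k : ℕ}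
    (hN : (64 : ℝ) ≤ k) (hNq : 32 * q ≤ k) (hq : 2 ≤ q) (hb : 1 ≤ b) (hε : ε = 1 / (20 * b))
    (hC0 : 0 < C) (hC1 : C ≤ 1) (hu0 : ∀ ξ ∈ Ω, 0 ≤ u ξ) {p : Fin n → ℝ} (hp : p ∈ Ω)
    (hup : u p = 0) (hcomp : IsCompact {ξ ∈ Ω | u ξ ≤ C})
    (hE : ∀ ξ ∈ Ω, u ξ ≤ C → 0 < d + legendreF u ξ)
    (hsE : ∀ ξ ∈ Ω, u ξ ≤ C → C - u ξ ≤ 2 * (d + legendreF u ξ))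
    (hP : ∀ ξ ∈ Ω, u ξ ≤ C → ∑ i, (pd i u ξ) ^ 2 ≤ b * (d + legendreF u ξ) ^ 2)
    (hR : ∀ ξ ∈ Ω, u ξ ≤ C →
      Real.exp (α * lrho n u dv d0 ξ) / (d + legendreF u ξ) ^ (q - 2) ≤ b)
    (hRΦ : ∀ ξ ∈ Ω, u ξ ≤ C →
      Real.exp (α * lrho n u dv d0 ξ) / (d + legendreF u ξ) ^ (q - 2) * PhiU u ξ ≤ b)
    {ξ : Fin n → ℝ} (hξ : ξ ∈ Ω) (huξ : u ξ < C) {e : Fin n → ℝ} (he : e ⬝ᵥ e = 1) :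
    (C - u ξ) ^ k * Real.exp (α * lrho n u dv d0 ξ) * (d + legendreF u ξ) ^ (-q)
      * ip (hess u ξ) e e ≤ 2 * (b + 3 * b * (40 * b * ((k : ℝ) * n + 2 * (q + 2) * n
        + ((k : ℝ) * ((n : ℝ) + 2) ^ 2 + α ^ 2) + 2 * (k : ℝ) * b))) := by
  set m := mF n u dv d0 C d k α q ε with hm
  have hlS : ∀ y ∈ Ω, Sm (lrho n u dv d0) y := fun y hy => (l_id hΩ hu hpd heq hy).1
  have hb0 : 0 < b := by linarith
  have hε0 : 0 < ε := by rw [hε]; positivity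
  have hεb : ε * b = 1 / 20 := by rw [hε]; field_simp
  have mnn : ∀ y ∈ Ω, u y ≤ C → 0 ≤ m y := by
    intro y hy hyC
    have h1 := hE y hy hyC
    have h2 : 0 ≤ C - u y := by linarith
    rw [hm, mF]; positivity
  have mpos : ∀ y ∈ Ω, u y < C → 0 < m y := by
    intro y hy hyC
    have h1 := hE y hy hyC.le
    have h2 : 0 < C - u y := by linarith
    rw [hm, mF]; positivity
  -- maximum
  have hcont : ContinuousOn (fun z : (Fin n → ℝ) × (Fin n → ℝ) => m z.1 * ip (hess u z.1) z.2 z.2)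
      ({ξ ∈ Ω | u ξ ≤ C} ×ˢ {e : Fin n → ℝ | e ⬝ᵥ e = 1}) := by
    rintro ⟨y, a⟩ ⟨⟨hy, hyC⟩, -⟩
    apply ContinuousAt.continuousWithinAt
    have hf : ContinuousAt (fun z : (Fin n → ℝ) × (Fin n → ℝ) => z.1) (y, a) := continuousAt_fst
    refine ContinuousAt.mul ?_ ?_
    · exact ContinuousAt.comp (f := fun z : (Fin n → ℝ) × (Fin n → ℝ) => z.1) (g := m)
        (mF_cont (hu y hy) (hlS y hy) (hE y hy hyC)) hf
    · simp only [ip_eq]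
      refine tendsto_finsetSum _ fun i _ => tendsto_finsetSum _ fun j _ => ?_
      refine ContinuousAt.mul (ContinuousAt.mul ?_ ?_) ?_
      · exact ContinuousAt.comp (f := fun z : (Fin n → ℝ) × (Fin n → ℝ) => z.1)
          (g := fun y => hess u y i j) (Sm_hess (hu y hy) i j).continuousAt hf
      · exact ((continuous_apply i).comp continuous_snd).continuousAt
      · exact ((continuous_apply j).comp continuous_snd).continuousAt
  obtain ⟨⟨x, e0⟩, ⟨⟨hx, hxC⟩, he0⟩, hmaxG⟩ := (hcomp.prod (compact_sphere n)).exists_isMaxOn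
    ⟨(ξ, e), ⟨⟨hξ, huξ.le⟩, he⟩⟩ hcont
  have hG : ∀ y ∈ Ω, u y ≤ C → ∀ a : Fin n → ℝ, a ⬝ᵥ a = 1 →
      m y * ip (hess u y) a a ≤ m x * ip (hess u x) e0 e0 := by
    intro y hy hyC a ha
    exact hmaxG (show (y, a) ∈ _ from ⟨⟨hy, hyC⟩, ha⟩)
  simp only at hx hxC he0
  have he0' : e0 ⬝ᵥ e0 = 1 := he0
  have unz : ∀ a : Fin n → ℝ, a ⬝ᵥ a = 1 → a ≠ 0 := by
    rintro a ha rfl; simp at ha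
  have hGpos : 0 < m x * ip (hess u x) e0 e0 :=
    lt_of_lt_of_le (mul_pos (mpos ξ hξ huξ) (ip_pos (hpd ξ hξ) (unz e he))) (hG ξ hξ huξ.le e he)
  have hlam : 0 < ip (hess u x) e0 e0 := ip_pos (hpd x hx) (unz e0 he0')
  have hmx : 0 < m x := pos_of_mul_pos_left hGpos hlam.le
  have hk0 : k ≠ 0 := by rintro rfl; norm_num at hN
  have hxC' : u x < C := by
    refine lt_of_le_of_ne hxC fun h => ?_
    rw [hm, mF, h, sub_self, zero_pow hk0] at hmx
    simp at hmx
  have hs : 0 < C - u x := by linarith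
  have hEx := hE x hx hxC
  -- direction
  have hdir : ∀ a : Fin n → ℝ, a ⬝ᵥ a = 1 → ip (hess u x) a a ≤ ip (hess u x) e0 e0 :=
    fun a ha => le_of_mul_le_mul_left (hG x hx hxC a ha) hmx
  -- local max of phiT
  have hexp : ∀ y ∈ Ω, u y < C → m y * ip (hess u y) e0 e0 =
      Real.exp (phiT (k : ℝ) α q ε (fun y => C - u y) (lrho n u dv d0) (wdir u e0)
      (fun y => d + legendreF u y) (fun y => ∑ i, (pd i u y) ^ 2) y) := by
    intro y hy hyC
    have h1 := hE y hy hyC.le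
    have h2 : 0 < C - u y := by linarith
    have h3 := (w_id hΩ hu hpd heq hy e0).2.1
    have h4 : 0 < ip (hess u y) e0 e0 := ip_pos (hpd y hy) (unz e0 he0')
    rw [phiT, Real.exp_add, Real.exp_add, Real.exp_add, Real.exp_add, h3, Real.exp_log h4, hm, mF,
      Real.rpow_def_of_pos h1, Real.exp_nat_mul, Real.exp_log h2, mul_comm (-q)]
    ring
  have hloc : IsLocalMax (phiT (k : ℝ) α q ε (fun y => C - u y) (lrho n u dv d0) (wdir u e0)
      (fun y => d + legendreF u y) (fun y => ∑ i, (pd i u y) ^ 2)) x := by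
    have c1 : ∀ᶠ y in 𝓝 x, y ∈ Ω := hΩ.mem_nhds hx
    have c2 : ∀ᶠ y in 𝓝 x, u y < C := (hu x hx).continuousAt.eventually_lt continuousAt_const hxC'
    filter_upwards [c1, c2] with y hy hyC
    have := hG y hy hyC.le e0 he0'
    rw [hexp y hy hyC, hexp x hx hxC'] at this
    exact Real.exp_le_exp.1 this
  have key := key_point hΩ hu hpd heq hx (C := C) (d := d) (N := (k : ℝ)) (α := α) (q := q)
    hN hNq hq hb hε hs hEx he0' hdir (hP x hx hxC) hloc
  have hΦ : 0 ≤ PhiU u x := by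
    rw [Phi_id hΩ hu hpd heq hx]
    exact ip_nonneg (hpd x hx).inv.posSemidef _
  set R := Real.exp (α * lrho n u dv d0 x) / (d + legendreF u x) ^ (q - 2) with hRdef
  have hk2 : 2 ≤ k := by
    have : (2 : ℝ) ≤ k := by linarith
    exact_mod_cast this
  have W := key_scalar (R := R) hk2 rfl hq hb hε hEx hs (by linarith [hu0 x hx]) (hsE x hx hxC) hlam
    (Nat.cast_nonneg n) (by positivity) (hR x hx hxC) hΦ (hRΦ x hx hxC) key
  set M := b + 3 * b * (40 * b * ((k : ℝ) * n + 2 * (q + 2) * n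
        + ((k : ℝ) * ((n : ℝ) + 2) ^ 2 + α ^ 2) + 2 * (k : ℝ) * b)) with hM
  have hexp20 : Real.exp (1 / 20) ≤ 2 := by
    have h1 : (1 / 20 : ℝ) ≤ Real.log 2 := by
      have := Real.log_two_gt_d9; linarith
    calc Real.exp (1 / 20) ≤ Real.exp (Real.log 2) := Real.exp_le_exp.2 h1
      _ = 2 := Real.exp_log two_pos
  -- value at the maximum
  have hval : m x * ip (hess u x) e0 e0 ≤ 2 * M := by
    have e1 : ε * ((∑ i, (pd i u x) ^ 2) * ((d + legendreF u x) ^ 2)⁻¹) ≤ 1 / 20 := by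
      have h1 : (∑ i, (pd i u x) ^ 2) * ((d + legendreF u x) ^ 2)⁻¹ ≤ b := by
        rw [← div_eq_mul_inv, div_le_iff₀ (by positivity)]
        exact hP x hx hxC
      rw [← hεb]; gcongr
    have e2 := (Real.exp_le_exp.2 e1).trans hexp20
    have e3 : (d + legendreF u x) ^ (-q)
        = ((d + legendreF u x) ^ (q - 2))⁻¹ * ((d + legendreF u x) ^ 2)⁻¹ := by
      rw [← Real.rpow_neg hEx.le, ← Real.rpow_natCast, ← Real.rpow_neg hEx.le, ← Real.rpow_add hEx]
      congr 1; push_cast; ring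
    have e4 : m x * ip (hess u x) e0 e0
        = ((C - u x) ^ k * R * (ip (hess u x) e0 e0 / (d + legendreF u x) ^ 2))
          * Real.exp (ε * ((∑ i, (pd i u x) ^ 2) * ((d + legendreF u x) ^ 2)⁻¹)) := by
      rw [hm, mF, e3, hRdef]; ring
    rw [e4]
    have hW0 : 0 ≤ (C - u x) ^ k * R * (ip (hess u x) e0 e0 / (d + legendreF u x) ^ 2) := by
      positivity
    calc _ ≤ ((C - u x) ^ k * R * (ip (hess u x) e0 e0 / (d + legendreF u x) ^ 2)) * 2 := by
          gcongr
      _ ≤ M * 2 := by gcongr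
      _ = 2 * M := by ring
  refine le_trans ?_ ((hG ξ hξ huξ.le e he).trans hval)
  have hEξ := hE ξ hξ huξ.le
  have hsξ : 0 < C - u ξ := by linarith
  have hwξ : 0 < ip (hess u ξ) e e := ip_pos (hpd ξ hξ) (unz e he)
  have hone : 1 ≤ Real.exp (ε * ((∑ i, (pd i u ξ) ^ 2) * ((d + legendreF u ξ) ^ 2)⁻¹)) :=
    Real.one_le_exp (by positivity)
  rw [hm, mF]
  refine mul_le_mul_of_nonneg_right ?_ hwξ.le
  exact le_mul_of_one_le_right (by positivity) hone

end final

/-- Lemma 6.3: under the stated bounds there is a constant `d₂ > 0` depending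
only on `n`, `b₂` and `C` such that
`exp(−64(n−1)C/(C−u)) ρ^α (Σ u_{ii})/(d+f)^{2nα/(n+2)+2} ≤ d₂` on `S_u(p,C)`. -/
theorem lemma_6_3 (n : ℕ) (hn : 5 ≤ n) (b₂ : ℝ) (hb₂ : 0 ≤ b₂)
    (C : ℝ) (hC0 : 0 < C) (hC1 : C ≤ 1) :
    ∃ d₂ : ℝ, 0 < d₂ ∧
      ∀ (Ω : Set (Fin n → ℝ)), IsOpen Ω → Convex ℝ Ω →
      ∀ (u : (Fin n → ℝ) → ℝ), ContDiffOn ℝ (⊤ : ℕ∞) u Ω →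
        (∀ x ∈ Ω, (hess u x).PosDef) →
        ∀ (dv : Fin n → ℝ) (d0 : ℝ),
          (∀ ξ ∈ Ω,
            (hess u ξ).det = Real.exp (-(∑ i : Fin n, dv i * pd i u ξ) - d0)) →
          (∀ ξ ∈ Ω, 0 ≤ u ξ) →
          ∀ p ∈ Ω, u p = 0 →
          IsCompact {ξ ∈ Ω | u ξ ≤ C} →
          ∀ d : ℝ, 1 < d →
            (∀ ξ ∈ {ξ ∈ Ω | u ξ ≤ C},
              (∑ i : Fin n, (pd i u ξ) ^ 2) / (d + legendreF u ξ) ^ 2 ≤ b₂ ∧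
                (rhoU u ξ) ^ (alph n) /
                  (d + legendreF u ξ) ^ (2 * (n : ℝ) * alph n / ((n : ℝ) + 2)) ≤ b₂ ∧
                (rhoU u ξ) ^ (alph n) * PhiU u ξ /
                  (d + legendreF u ξ) ^ (2 * (n : ℝ) * alph n / ((n : ℝ) + 2)) ≤ b₂ ∧
                |u ξ + legendreF u ξ| ≤ d + legendreF u ξ) →
            ∀ ξ ∈ Ω, u ξ < C →
              Real.exp (-(64 * ((n : ℝ) - 1) * C) / (C - u ξ)) *
                  (rhoU u ξ) ^ (alph n) * (∑ i : Fin n, pd i (pd i u) ξ) /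
                  (d + legendreF u ξ) ^
                    (2 * (n : ℝ) * alph n / ((n : ℝ) + 2) + 2) ≤ d₂ := by
  classical
  set α := alph n with hα
  set q := 2 * (n : ℝ) * alph n / ((n : ℝ) + 2) + 2 with hq
  have hn5 : (5 : ℝ) ≤ n := by exact_mod_cast hn
  have hα0 : 0 ≤ α := by
    rw [hα, alph]
    have h1 : 0 ≤ (n : ℝ) - 3 := by linarith
    have h2 : 0 ≤ (n : ℝ) - 1 := by linarith
    positivity
  have hq2 : 2 ≤ q := by
    have : 0 ≤ 2 * (n : ℝ) * α / ((n : ℝ) + 2) := by positivity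
    rw [hq]; linarith
  obtain ⟨k, hk⟩ := exists_nat_ge (max 64 (32 * q))
  have hk64 : (64 : ℝ) ≤ k := (le_max_left _ _).trans hk
  have hkq : 32 * q ≤ k := (le_max_right _ _).trans hk
  set b := b₂ + 1 with hb
  have hb1 : 1 ≤ b := by linarith
  set M := 2 * (b + 3 * b * (40 * b * ((k : ℝ) * n + 2 * (q + 2) * n
        + ((k : ℝ) * ((n : ℝ) + 2) ^ 2 + α ^ 2) + 2 * (k : ℝ) * b))) with hM
  have hM0 : 0 < M := by rw [hM]; positivity
  set mm := 64 * ((n : ℝ) - 1) * C with hmm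
  have hmm0 : 0 < mm := by
    have : 0 < (n : ℝ) - 1 := by linarith
    rw [hmm]; positivity
  refine ⟨(k.factorial : ℝ) / mm ^ k * (n * M), by positivity, ?_⟩
  intro Ω hΩ _ u huC hpd dv d0 heq hu0 p hp hup hcomp d hd hyp ξ hξ huξ
  have hu : ∀ y ∈ Ω, Sm u y := fun y hy => huC.contDiffAt (hΩ.mem_nhds hy)
  have hq' : 2 * (n : ℝ) * alph n / ((n : ℝ) + 2) = q - 2 := by rw [hq]; ring
  rw [hq'] at hyp
  have hEs : ∀ y ∈ Ω, u y ≤ C → C - u y ≤ 2 * (d + legendreF u y) := by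
    intro y hy hyC
    have h1 := (hyp y ⟨hy, hyC⟩).2.2.2
    have h2 := (neg_le_abs _).trans h1
    linarith
  have hE : ∀ y ∈ Ω, u y ≤ C → 0 < d + legendreF u y := by
    intro y hy hyC
    have h1 := (hyp y ⟨hy, hyC⟩).2.2.2
    have h2 := (neg_le_abs _).trans h1
    linarith
  have hrho : ∀ y ∈ Ω, rhoU u y ^ α = Real.exp (α * lrho n u dv d0 y) := by
    intro y hy
    rw [(l_id hΩ hu hpd heq hy).2.2.2.eq_of_nhds, ← Real.exp_mul, mul_comm]
  have hb2b : b₂ ≤ b := by linarith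
  have main : ∀ e : Fin n → ℝ, dotProduct e e = 1 →
      (C - u ξ) ^ k * Real.exp (α * lrho n u dv d0 ξ) * (d + legendreF u ξ) ^ (-q)
      * ip (hess u ξ) e e ≤ M := by
    intro e he
    refine main_bound (by omega) hΩ hu hpd heq hk64 hkq hq2 hb1 rfl hC0 hC1 hu0 hp hup hcomp
      hE hEs ?_ ?_ ?_ hξ huξ he
    · intro y hy hyC
      have h1 := (hyp y ⟨hy, hyC⟩).1
      have h2 := hE y hy hyC
      rw [div_le_iff₀ (by positivity)] at h1
      refine h1.trans ?_
      gcongr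
    · intro y hy hyC
      have h1 := (hyp y ⟨hy, hyC⟩).2.1
      rw [hrho y hy] at h1
      linarith
    · intro y hy hyC
      have h1 := (hyp y ⟨hy, hyC⟩).2.2.1
      rw [hrho y hy, mul_div_right_comm] at h1
      linarith
  have hEξ := hE ξ hξ huξ.le
  have hs : 0 < C - u ξ := by linarith
  have htr : ∑ i : Fin n, pd i (pd i u) ξ
      = ∑ i : Fin n, ip (hess u ξ) (Pi.single i 1) (Pi.single i 1) := by
    refine Finset.sum_congr rfl fun i _ => ?_
    simp [ip, hess]
  have hsum : (C - u ξ) ^ k * Real.exp (α * lrho n u dv d0 ξ) * (d + legendreF u ξ) ^ (-q)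
      * (∑ i : Fin n, pd i (pd i u) ξ) ≤ n * M := by
    rw [htr, Finset.mul_sum]
    calc _ ≤ ∑ i : Fin n, M := Finset.sum_le_sum fun i _ => main _ (by simp)
      _ = n * M := by simp
  have hexp : Real.exp (-mm / (C - u ξ)) ≤ (k.factorial : ℝ) / mm ^ k * (C - u ξ) ^ k := by
    have h1 := Real.pow_div_factorial_le_exp (mm / (C - u ξ)) (by positivity) k
    have h2 : Real.exp (-mm / (C - u ξ)) = (Real.exp (mm / (C - u ξ)))⁻¹ := by
      rw [← Real.exp_neg]; congr 1; ring
    rw [h2]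
    have h3 : (k.factorial : ℝ) / mm ^ k * (C - u ξ) ^ k
        = ((mm / (C - u ξ)) ^ k / (k.factorial : ℝ))⁻¹ := by
      rw [div_pow, inv_div, div_div_eq_mul_div]; ring
    rw [h3]
    exact inv_anti₀ (by positivity) h1
  have htr0 : 0 ≤ ∑ i : Fin n, pd i (pd i u) ξ := by
    rw [htr]
    exact Finset.sum_nonneg fun i _ => ip_nonneg (hpd ξ hξ).posSemidef _
  rw [hrho ξ hξ, div_eq_mul_inv, ← Real.rpow_neg hEξ.le]
  calc Real.exp (-mm / (C - u ξ)) * Real.exp (α * lrho n u dv d0 ξ)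
        * (∑ i : Fin n, pd i (pd i u) ξ) * (d + legendreF u ξ) ^ (-q)
      ≤ ((k.factorial : ℝ) / mm ^ k * (C - u ξ) ^ k) * Real.exp (α * lrho n u dv d0 ξ)
        * (∑ i : Fin n, pd i (pd i u) ξ) * (d + legendreF u ξ) ^ (-q) := by gcongr
    _ = (k.factorial : ℝ) / mm ^ k * ((C - u ξ) ^ k * Real.exp (α * lrho n u dv d0 ξ)
        * (d + legendreF u ξ) ^ (-q) * (∑ i : Fin n, pd i (pd i u) ξ)) := by ring
    _ ≤ (k.factorial : ℝ) / mm ^ k * (n * M) := by gcongr
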